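/- arXiv:2504.02650 — 6 statements merged into one kernel-verified Lean document; each statement's English description precedes it below -/
import Mathlib

section
/- Let Π and Π' be two Π4°-free pre-rotation systems on the same finite set V. Then Π and Π' have exactly the same set of crossing pairs of disjoint edges if and only if Π' is equal to Π or to the reflection of Π. -/
/-!
Common definitions for pre-rotation systems of simple drawings of complete graphs.

A cyclic permutation of a finite set `S` is modelled by an `Equiv.Perm` that fixes
everything outside `S` and has all of `S` in one cycle.  The ternary relation
`CycOrd f S b c d` expresses that, traversing the cycle of `f` starting at `b`,
one meets `c` strictly before `d` (within one full period).  For sets with at least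
three elements, a cyclic permutation is uniquely determined by this ternary relation,
so equality of induced subconfigurations is expressed via `CycOrd`.
-/

section Defs

variable {α : Type*}

/-- `f` is a cyclic permutation of the finite set `S`: it fixes every point outside `S`
and all elements of `S` lie on one common cycle of `f`. -/
def IsCyclicPermOn (f : Equiv.Perm α) (S : Finset α) : Prop :=
  (∀ a ∉ S, f a = a) ∧ ∀ a ∈ S, ∀ b ∈ S, ∃ k : ℕ, (⇑f)^[k] a = b

/-- `b, c, d` appear in this cyclic order in the cyclic permutation `f` of the set `S`:
traversing the cycle starting at `b`, one meets `c` strictly before `d`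
(both within one full period). -/
def CycOrd (f : Equiv.Perm α) (S : Finset α) (b c d : α) : Prop :=
  ∃ i j : ℕ, 0 < i ∧ i < j ∧ j < S.card ∧ (⇑f)^[i] b = c ∧ (⇑f)^[j] b = d

/-- A pre-rotation system on the finite vertex set `α`: every vertex `v` is assigned a
cyclic permutation of the remaining vertices. -/
structure PreRotSys (α : Type*) [Fintype α] [DecidableEq α] where
  rot : α → Equiv.Perm α
  cyc : ∀ v, IsCyclicPermOn (rot v) (Finset.univ.erase v)

variable [Fintype α] [DecidableEq α]

/-- `b, c, d` appear in this cyclic (counterclockwise) order in the rotation of `v`. -/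
def rotOrd (P : PreRotSys α) (v b c d : α) : Prop :=
  CycOrd (P.rot v) (Finset.univ.erase v) b c d

/-- `P'` is the reflection of `P`: every cyclic permutation is reversed. -/
def IsReflection (P P' : PreRotSys α) : Prop :=
  ∀ v, P'.rot v = (P.rot v)⁻¹

/-- `P` is Π4°-free: no induced subconfiguration on four elements is (up to relabelling,
possibly followed by reflection) the obstruction Π4° with
π_a=(b,c,d), π_b=(a,c,d), π_c=(a,b,d), π_d=(a,c,b). -/
def Pi4Free (P : PreRotSys α) : Prop :=
  ∀ a b c d : α, a ≠ b → a ≠ c → a ≠ d → b ≠ c → b ≠ d → c ≠ d →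
    ¬ (rotOrd P a b c d ∧ rotOrd P b a c d ∧ rotOrd P c a b d ∧ rotOrd P d a c b) ∧
    ¬ (rotOrd P a b d c ∧ rotOrd P b a d c ∧ rotOrd P c a d b ∧ rotOrd P d a b c)

/-- The disjoint edges `{p, r}` and `{q, s}` cross: the induced subconfiguration on
`{p, q, r, s}` is, possibly after reversing all four cyclic permutations, equal to
π_p=(q,r,s), π_q=(p,r,s), π_r=(p,q,s), π_s=(p,q,r). -/
def Crosses (P : PreRotSys α) (p q r s : α) : Prop :=
  (p ≠ q ∧ p ≠ r ∧ p ≠ s ∧ q ≠ r ∧ q ≠ s ∧ r ≠ s) ∧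
  ((rotOrd P p q r s ∧ rotOrd P q p r s ∧ rotOrd P r p q s ∧ rotOrd P s p q r) ∨
   (rotOrd P p q s r ∧ rotOrd P q p s r ∧ rotOrd P r p s q ∧ rotOrd P s p r q))

/-- Two pre-rotation systems are isomorphic: one is obtained from the other by
relabelling the elements, possibly followed by reflection. -/
def IsoPRS (P P' : PreRotSys α) : Prop :=
  ∃ e : Equiv.Perm α,
    (∀ v, P'.rot (e v) = e * P.rot v * e⁻¹) ∨
    (∀ v, P'.rot (e v) = (e * P.rot v * e⁻¹)⁻¹)

/-- The induced subconfigurations `P|_I` and `P'|_I` are equal (expressed via the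
ternary cyclic-order relations, which determine cyclic permutations of sets with
at least three elements). -/
def RestrictEq (P P' : PreRotSys α) (I : Finset α) : Prop :=
  ∀ v ∈ I, ∀ b ∈ I, ∀ c ∈ I, ∀ d ∈ I, (rotOrd P v b c d ↔ rotOrd P' v b c d)

/-- The induced subconfiguration `P'|_I` is the reflection of `P|_I` (expressed via
the ternary cyclic-order relations). -/
def RestrictReflEq (P P' : PreRotSys α) (I : Finset α) : Prop :=
  ∀ v ∈ I, ∀ b ∈ I, ∀ c ∈ I, ∀ d ∈ I, (rotOrd P' v b c d ↔ rotOrd P v b d c)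

/-- The `k` distinct elements `u 0, …, u (k-1)` form a perfect twisted configuration `T_k`:
for all `a < b < c < d`, the disjoint edges `{u a, u d}` and `{u b, u c}` cross, and no
other pair of disjoint edges among them crosses. -/
def TwistedTuple (P : PreRotSys α) {k : ℕ} (u : Fin k → α) : Prop :=
  ∀ a b c d : Fin k, a < b → b < c → c < d →
    Crosses P (u a) (u b) (u d) (u c) ∧
    ¬ Crosses P (u a) (u c) (u b) (u d) ∧
    ¬ Crosses P (u a) (u b) (u c) (u d)

/-- `P` is generalized twisted: it is Π4°-free and every induced subconfiguration on
five elements is of twisted type (i.e. can be labelled so as to form a `T_5`). -/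
def GenTwisted (P : PreRotSys α) : Prop :=
  Pi4Free P ∧
    ∀ w : Fin 5 → α, Function.Injective w →
      ∃ e : Equiv.Perm (Fin 5), TwistedTuple P (fun x => w (e x))

/-- `P` contains `T_k`, the perfect twisted drawing on `k` vertices. -/
def ContainsT (P : PreRotSys α) (k : ℕ) : Prop :=
  ∃ u : Fin k → α, Function.Injective u ∧ TwistedTuple P u

end Defs

section CyclicOrder

variable {α : Type*} {f g : Equiv.Perm α} {S : Finset α} {b c d e : α}

theorem IsCyclicPermOn.isCycleOn (hf : IsCyclicPermOn f S) : f.IsCycleOn S := by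
  have maps : ∀ a ∈ S, f a ∈ S := by
    intro a ha
    by_contra h
    rw [f.injective (hf.1 _ h)] at h
    exact h ha
  refine ⟨Set.BijOn.mk maps f.injective.injOn ?_, ?_⟩
  · intro a ha
    obtain ⟨k, hk⟩ := hf.2 (f a) (maps a ha) a ha
    refine ⟨f^[k] a, Set.MapsTo.iterate (s := (S : Set α)) maps k ha, ?_⟩
    exact (Function.iterate_succ_apply' f k a).symm.trans
      ((Function.iterate_succ_apply f k a).trans hk)
  · intro a ha b hb
    obtain ⟨k, hk⟩ := hf.2 a ha b hb
    exact ⟨k, by simpa [← Equiv.Perm.iterate_eq_pow] using hk⟩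

/-- The position along the cycle starting at `b` turns the cyclic order into a linear order. -/
theorem IsCyclicPermOn.exists_position (hf : IsCyclicPermOn f S) (hb : b ∈ S) :
    ∃ k : α → ℕ, (∀ c ∈ S, f^[k c] b = c ∧ k c < S.card ∧ (c ≠ b → 0 < k c)) ∧
      ∀ c ∈ S, ∀ i < S.card, f^[i] b = c → i = k c := by
  have H := hf.isCycleOn
  choose! k hk using fun c (hc : c ∈ S) => H.exists_pow_eq hb hc
  refine ⟨k, fun c hc =>
    ⟨by simpa [Equiv.Perm.iterate_eq_pow] using (hk c hc).2, (hk c hc).1, ?_⟩, ?_⟩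
  · intro hcb
    by_contra h0
    have h := (hk c hc).2
    rw [Nat.eq_zero_of_not_pos h0] at h
    exact hcb h.symm
  · intro c hc i hi h
    rw [Equiv.Perm.iterate_eq_pow] at h
    have := (H.pow_apply_eq_pow_apply hb).1 (h.trans (hk c hc).2.symm)
    exact Nat.ModEq.eq_of_lt_of_lt this hi (hk c hc).1

theorem IsCyclicPermOn.exists_cycOrd_iff_lt (hf : IsCyclicPermOn f S) (hb : b ∈ S) :
    ∃ k : α → ℕ, Set.InjOn k S ∧
      ∀ c ∈ S, ∀ d ∈ S, c ≠ b → (CycOrd f S b c d ↔ k c < k d) := by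
  obtain ⟨k, hk, huniq⟩ := hf.exists_position hb
  refine ⟨k, fun c hc d hd h => by rw [← (hk c hc).1, ← (hk d hd).1, h], ?_⟩
  intro c hc d hd hcb
  constructor
  · rintro ⟨i, j, _, hij, hj, hi', hj'⟩
    rwa [← huniq c hc i (hij.trans hj) hi', ← huniq d hd j hj hj']
  · intro h
    exact ⟨k c, k d, (hk c hc).2.2 hcb, h, (hk d hd).2.1, (hk c hc).1, (hk d hd).1⟩

theorem CycOrd.rotate (hf : IsCyclicPermOn f S) (hb : b ∈ S) (h : CycOrd f S b c d) :
    CycOrd f S c d b := by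
  obtain ⟨i, j, hi, hij, hj, rfl, rfl⟩ := h
  refine ⟨j - i, S.card - i, by omega, by omega, by omega, ?_, ?_⟩
  · rw [← Function.iterate_add_apply, Nat.sub_add_cancel hij.le]
  · rw [← Function.iterate_add_apply, Nat.sub_add_cancel (hij.trans hj).le,
      Equiv.Perm.iterate_eq_pow]
    exact hf.isCycleOn.pow_card_apply hb

theorem cycOrd_rotate_iff (hf : IsCyclicPermOn f S) (hb : b ∈ S) (hc : c ∈ S) (hd : d ∈ S) :
    CycOrd f S c d b ↔ CycOrd f S b c d :=
  ⟨fun h => (h.rotate hf hc).rotate hf hd, fun h => h.rotate hf hb⟩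

theorem cycOrd_swap_iff (hf : IsCyclicPermOn f S) (hb : b ∈ S) (hc : c ∈ S) (hd : d ∈ S)
    (hbc : b ≠ c) (hbd : b ≠ d) (hcd : c ≠ d) :
    CycOrd f S b d c ↔ ¬ CycOrd f S b c d := by
  obtain ⟨k, hinj, hk⟩ := hf.exists_cycOrd_iff_lt hb
  rw [hk c hc d hd hbc.symm, hk d hd c hc hbd.symm]
  have : k c ≠ k d := fun h => hcd (hinj hc hd h)
  omega

theorem CycOrd.trans (hf : IsCyclicPermOn f S) (hb : b ∈ S) (hc : c ∈ S) (hd : d ∈ S)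
    (he : e ∈ S) (hbc : b ≠ c) (hbd : b ≠ d) (h : CycOrd f S b c d) (h' : CycOrd f S b d e) :
    CycOrd f S b c e := by
  obtain ⟨k, -, hk⟩ := hf.exists_cycOrd_iff_lt hb
  rw [hk c hc _ ‹_› hbc.symm] at h ⊢
  rw [hk d hd e he hbd.symm] at h'
  exact h.trans h'

/-- Among the four triples of a four-element cyclic order, listed with respect to a fixed
linear order, an even number is positively oriented. -/
theorem cycOrd_parity (hf : IsCyclicPermOn f S) (hb : b ∈ S) (hc : c ∈ S) (hd : d ∈ S)
    (he : e ∈ S) (hbc : b ≠ c) (hbd : b ≠ d) (hbe : b ≠ e) (hcd : c ≠ d) (hce : c ≠ e)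
    (hde : d ≠ e) :
    (CycOrd f S b c d ↔ CycOrd f S b c e) ↔ (CycOrd f S b d e ↔ CycOrd f S c d e) := by
  have r : ∀ {x y z : α}, x ∈ S → y ∈ S → z ∈ S → (CycOrd f S y z x ↔ CycOrd f S x y z) :=
    cycOrd_rotate_iff hf
  have s : ∀ {x y z : α}, x ∈ S → y ∈ S → z ∈ S → x ≠ y → x ≠ z → y ≠ z →
      (CycOrd f S x z y ↔ ¬ CycOrd f S x y z) := cycOrd_swap_iff hf
  have t : ∀ {x y z w : α}, x ∈ S → y ∈ S → z ∈ S → w ∈ S → x ≠ y → x ≠ z →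
      CycOrd f S x y z → CycOrd f S x z w → CycOrd f S x y w := CycOrd.trans hf
  have b1 := t hb hc hd he hbc hbd
  have b2 := t hb hd hc he hbd hbc
  have b3 := t hb hc he hd hbc hbe
  have b4 := t hb he hc hd hbe hbc
  have b5 := t hb hd he hc hbd hbe
  have b6 := t hb he hd hc hbe hbd
  have c1 := t hc hb hd he hbc.symm hcd
  have c2 := t hc hd hb he hcd hbc.symm
  have c3 := t hc hb he hd hbc.symm hce
  have c4 := t hc he hb hd hce hbc.symm
  have c5 := t hc hd he hb hcd hce
  have c6 := t hc he hd hb hce hcd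
  have d1 := t hd hb hc he hbd.symm hcd.symm
  have d2 := t hd hc hb he hcd.symm hbd.symm
  have d3 := t hd hb he hc hbd.symm hde
  have d4 := t hd he hb hc hde hbd.symm
  have d5 := t hd hc he hb hcd.symm hde
  have d6 := t hd he hc hb hde hcd.symm
  have e1 := t he hb hc hd hbe.symm hce.symm
  have e2 := t he hc hb hd hce.symm hbe.symm
  have e3 := t he hb hd hc hbe.symm hde.symm
  have e4 := t he hd hb hc hde.symm hbe.symm
  have e5 := t he hc hd hb hce.symm hde.symm
  have e6 := t he hd hc hb hde.symm hce.symm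
  have q1 := r hb hc hd
  have q2 := r hc hd hb
  have q3 := r hb hd hc
  have q4 := r hd hc hb
  have q5 := s hb hc hd hbc hbd hcd
  have q6 := r hb hc he
  have q7 := r hc he hb
  have q8 := r hb he hc
  have q9 := r he hc hb
  have q10 := s hb hc he hbc hbe hce
  have q11 := r hb hd he
  have q12 := r hd he hb
  have q13 := r hb he hd
  have q14 := r he hd hb
  have q15 := s hb hd he hbd hbe hde
  have q16 := r hc hd he
  have q17 := r hd he hc
  have q18 := r hc he hd
  have q19 := r he hd hc
  have q20 := s hc hd he hcd hce hde
  clear r s t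
  grind

theorem cycOrd_inv (hf : IsCyclicPermOn f S) (hb : b ∈ S) (h : CycOrd f S b c d) :
    CycOrd f⁻¹ S b d c := by
  obtain ⟨i, j, hi, hij, hj, rfl, rfl⟩ := h
  have key : ∀ m ≤ S.card, (⇑f⁻¹)^[S.card - m] b = f^[m] b := by
    intro m hm
    have hb' : f^[S.card - m] (f^[m] b) = b := by
      rw [← Function.iterate_add_apply, Nat.sub_add_cancel hm, Equiv.Perm.iterate_eq_pow]
      exact hf.isCycleOn.pow_card_apply hb
    rw [Equiv.Perm.iterate_eq_pow] at hb'
    rw [Equiv.Perm.iterate_eq_pow, inv_pow, Equiv.Perm.inv_eq_iff_eq, hb']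
  exact ⟨S.card - j, S.card - i, by omega, by omega, by omega, key j hj.le, key i (by omega)⟩

theorem IsCyclicPermOn.inv (hf : IsCyclicPermOn f S) : IsCyclicPermOn f⁻¹ S := by
  refine ⟨fun a ha => by rw [Equiv.Perm.inv_eq_iff_eq, hf.1 a ha], fun a ha b hb => ?_⟩
  obtain ⟨k, hk⟩ := hf.2 b hb a ha
  refine ⟨k, ?_⟩
  rw [Equiv.Perm.iterate_eq_pow] at hk
  rw [Equiv.Perm.iterate_eq_pow, inv_pow, Equiv.Perm.inv_eq_iff_eq, hk]

theorem cycOrd_inv_iff (hf : IsCyclicPermOn f S) (hb : b ∈ S) :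
    CycOrd f⁻¹ S b c d ↔ CycOrd f S b d c :=
  ⟨fun h => by simpa using cycOrd_inv hf.inv hb h, cycOrd_inv hf hb⟩

/-- A cyclic permutation is determined by its ternary cyclic order. -/
theorem IsCyclicPermOn.ext (hf : IsCyclicPermOn f S) (hg : IsCyclicPermOn g S)
    (h : ∀ b ∈ S, ∀ c ∈ S, ∀ d ∈ S, b ≠ c → b ≠ d → c ≠ d →
      (CycOrd f S b c d ↔ CycOrd g S b c d)) : f = g := by
  have key : ∀ {p : Equiv.Perm α}, IsCyclicPermOn p S → ∀ b ∈ S, ∀ c ∈ S, c ≠ b →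
      p b ∈ S ∧ p b ≠ b ∧ (p b ≠ c → CycOrd p S b (p b) c) := by
    intro p hp b hb c hc hcb
    have hcard : 1 < S.card := Finset.one_lt_card.2 ⟨c, hc, b, hb, hcb⟩
    obtain ⟨k, hk, huniq⟩ := hp.exists_position hb
    have hmem : p b ∈ S := hp.isCycleOn.1.mapsTo hb
    refine ⟨hmem, ?_, ?_⟩
    · intro hfix
      have h0 := huniq b hb 0 (by omega) rfl
      have h1 := huniq b hb 1 hcard hfix
      omega
    · intro hne
      refine ⟨1, k c, one_pos, ?_, (hk c hc).2.1, rfl, (hk c hc).1⟩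
      have hpos := (hk c hc).2.2 hcb
      have : k c ≠ 1 := fun h1 => hne (by rw [← (hk c hc).1, h1]; rfl)
      omega
  ext b
  by_cases hb : b ∈ S
  · by_cases hsub : ∃ c ∈ S, c ≠ b
    · obtain ⟨c, hc, hcb⟩ := hsub
      obtain ⟨hfS, hfb, -⟩ := key hf b hb c hc hcb
      obtain ⟨hgS, hgb, -⟩ := key hg b hb c hc hcb
      by_contra hne
      have h1 := (key hf b hb _ hgS hgb).2.2 hne
      have h2 := (key hg b hb _ hfS hfb).2.2 (Ne.symm hne)
      rw [h b hb _ hfS _ hgS hfb.symm hgb.symm hne] at h1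
      exact (cycOrd_swap_iff hg hb hgS hfS hgb.symm hfb.symm (Ne.symm hne)).1 h1 h2
    · push Not at hsub
      rw [hsub _ (hf.isCycleOn.1.mapsTo hb), hsub _ (hg.isCycleOn.1.mapsTo hb)]
  · rw [hf.1 b hb, hg.1 b hb]

end CyclicOrder

section RotationSystems

variable {α : Type*} [Fintype α] [DecidableEq α] {P P' : PreRotSys α} {v a b c d e : α}

theorem rotOrd_rotate_iff (P : PreRotSys α) (hb : v ≠ b) (hc : v ≠ c) (hd : v ≠ d) :
    rotOrd P v c d b ↔ rotOrd P v b c d :=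
  cycOrd_rotate_iff (P.cyc v) (by simp [hb.symm]) (by simp [hc.symm]) (by simp [hd.symm])

theorem rotOrd_swap_iff (P : PreRotSys α) (hb : v ≠ b) (hc : v ≠ c) (hd : v ≠ d)
    (hbc : b ≠ c) (hbd : b ≠ d) (hcd : c ≠ d) :
    rotOrd P v b d c ↔ ¬ rotOrd P v b c d :=
  cycOrd_swap_iff (P.cyc v) (by simp [hb.symm]) (by simp [hc.symm]) (by simp [hd.symm])
    hbc hbd hcd

/-- The six cyclic-order statements about three elements in terms of a single one. -/
theorem rotOrd_normalize (P : PreRotSys α) (hb : v ≠ b) (hc : v ≠ c) (hd : v ≠ d)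
    (hbc : b ≠ c) (hbd : b ≠ d) (hcd : c ≠ d) :
    (rotOrd P v c d b ↔ rotOrd P v b c d) ∧ (rotOrd P v d b c ↔ rotOrd P v b c d) ∧
    (rotOrd P v b d c ↔ ¬ rotOrd P v b c d) ∧ (rotOrd P v d c b ↔ ¬ rotOrd P v b c d) ∧
    (rotOrd P v c b d ↔ ¬ rotOrd P v b c d) := by
  have h1 := rotOrd_rotate_iff P hb hc hd
  have h2 := rotOrd_rotate_iff P hc hd hb
  have h3 := rotOrd_swap_iff P hb hc hd hbc hbd hcd
  have h4 := rotOrd_rotate_iff P hb hd hc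
  have h5 := rotOrd_rotate_iff P hd hc hb
  tauto

/-- The orientations of a Π4°-free four-element subconfiguration satisfy a parity condition. -/
theorem Pi4Free.parity (hP : Pi4Free P) (hab : a ≠ b) (hac : a ≠ c) (had : a ≠ d) (hbc : b ≠ c)
    (hbd : b ≠ d) (hcd : c ≠ d) :
    (rotOrd P a b c d ↔ rotOrd P b a c d) ↔ (rotOrd P c a b d ↔ rotOrd P d a b c) := by
  have na := rotOrd_normalize P hab hac had hbc hbd hcd
  have nb := rotOrd_normalize P hab.symm hbc hbd hac had hcd
  have nc := rotOrd_normalize P hac.symm hbc.symm hcd hab had hbd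
  have nd := rotOrd_normalize P had.symm hbd.symm hcd.symm hab hac hbc
  have h1 := hP a b c d hab hac had hbc hbd hcd
  have h2 := hP b c d a hbc hbd hab.symm hcd hac.symm had.symm
  have h3 := hP c d a b hcd hac.symm hbc.symm had.symm hbd.symm hab
  have h4 := hP d a b c had.symm hbd.symm hcd.symm hab hac hbc
  simp only [na, nb, nc, nd] at h1 h2 h3 h4
  clear na nb nc nd hP
  grind

theorem crosses_iff (P : PreRotSys α) (hab : a ≠ b) (hac : a ≠ c) (had : a ≠ d) (hbc : b ≠ c)
    (hbd : b ≠ d) (hcd : c ≠ d) :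
    Crosses P a b c d ↔
      (rotOrd P a b c d ↔ rotOrd P b a c d) ∧ (rotOrd P b a c d ↔ rotOrd P c a b d) ∧
      (rotOrd P c a b d ↔ rotOrd P d a b c) := by
  have na := rotOrd_normalize P hab hac had hbc hbd hcd
  have nb := rotOrd_normalize P hab.symm hbc hbd hac had hcd
  have nc := rotOrd_normalize P hac.symm hbc.symm hcd hab had hbd
  have nd := rotOrd_normalize P had.symm hbd.symm hcd.symm hab hac hbc
  simp only [Crosses, na, nb, nc, nd]
  clear na nb nc nd
  grind

/-- `P` and `P'` order `b, c, d` around `v` in the same way. -/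
def Agree (P P' : PreRotSys α) (v b c d : α) : Prop :=
  rotOrd P v b c d ↔ rotOrd P' v b c d

theorem agree_rotate_iff (hb : v ≠ b) (hc : v ≠ c) (hd : v ≠ d) :
    Agree P P' v c d b ↔ Agree P P' v b c d := by
  simp only [Agree, rotOrd_rotate_iff _ hb hc hd]

theorem agree_swap_iff (hb : v ≠ b) (hc : v ≠ c) (hd : v ≠ d) (hbc : b ≠ c) (hbd : b ≠ d)
    (hcd : c ≠ d) : Agree P P' v b d c ↔ Agree P P' v b c d := by
  simp only [Agree, rotOrd_swap_iff _ hb hc hd hbc hbd hcd]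
  tauto

/-- A Π4°-free four-element subconfiguration is determined by its crossings up to reflection,
so agreement at one vertex is equivalent to agreement at any other. -/
theorem agree_vertex_swap_iff (hP : Pi4Free P) (hP' : Pi4Free P')
    (h : ∀ p q r s : α, Crosses P p q r s ↔ Crosses P' p q r s)
    (hab : a ≠ b) (hac : a ≠ c) (had : a ≠ d) (hbc : b ≠ c) (hbd : b ≠ d) (hcd : c ≠ d) :
    Agree P P' b a c d ↔ Agree P P' a b c d := by
  have p := hP.parity hab hac had hbc hbd hcd
  have p' := hP'.parity hab hac had hbc hbd hcd
  have h1 := h a b c d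
  have h2 := h a c b d
  have h3 := h a b d c
  rw [crosses_iff _ hab hac had hbc hbd hcd, crosses_iff _ hab hac had hbc hbd hcd] at h1
  rw [crosses_iff _ hac hab had hbc.symm hcd hbd, crosses_iff _ hac hab had hbc.symm hcd hbd] at h2
  rw [crosses_iff _ hab had hac hbd hbc hcd.symm, crosses_iff _ hab had hac hbd hbc hcd.symm] at h3
  have na := fun Q : PreRotSys α => rotOrd_normalize Q hab hac had hbc hbd hcd
  have nb := fun Q : PreRotSys α => rotOrd_normalize Q hab.symm hbc hbd hac had hcd
  have nd := fun Q : PreRotSys α => rotOrd_normalize Q had.symm hbd.symm hcd.symm hab hac hbc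
  simp only [na, nb, nd] at h1 h2 h3
  clear na nb nd h
  unfold Agree
  grind

theorem agree_parity (P P' : PreRotSys α) (hb : v ≠ b) (hc : v ≠ c) (hd : v ≠ d) (he : v ≠ e)
    (hbc : b ≠ c) (hbd : b ≠ d) (hbe : b ≠ e) (hcd : c ≠ d) (hce : c ≠ e) (hde : d ≠ e) :
    (Agree P P' v b c d ↔ Agree P P' v b c e) ↔ (Agree P P' v b d e ↔ Agree P P' v c d e) := by
  have key : ∀ Q : PreRotSys α,
      (rotOrd Q v b c d ↔ rotOrd Q v b c e) ↔ (rotOrd Q v b d e ↔ rotOrd Q v c d e) :=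
    fun Q => cycOrd_parity (Q.cyc v) (by simp [hb.symm]) (by simp [hc.symm]) (by simp [hd.symm])
      (by simp [he.symm]) hbc hbd hbe hcd hce hde
  have h := key P
  have h' := key P'
  clear key
  unfold Agree
  grind

/-- A symmetric predicate on quadruples of distinct elements that is insensitive to replacing
an entry takes the same value on all such quadruples. -/
theorem quadruple_iff_of_exchange {α : Type*} {A : α → α → α → α → Prop}
    (swap₁ : ∀ a b c d, [a, b, c, d].Nodup → (A a b c d → A b a c d))
    (swap₂ : ∀ a b c d, [a, b, c, d].Nodup → (A a b c d → A a c b d))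
    (swap₃ : ∀ a b c d, [a, b, c, d].Nodup → (A a b c d → A a b d c))
    (exchange : ∀ a b c d e, [a, b, c, d, e].Nodup → (A a b c d → A a b c e))
    {a b c d p q r s : α} (h : [a, b, c, d].Nodup) (h' : [p, q, r, s].Nodup)
    (hA : A a b c d) : A p q r s := by
  have first : ∃ b c d, [p, b, c, d].Nodup ∧ A p b c d := by
    have bring : ∀ x y z w, [x, y, z, w].Nodup → A x y z w → A w x y z := fun x y z w hn hA =>
      swap₁ _ _ _ _ (by clear * - hn; grind)
          (swap₂ _ _ _ _ (by clear * - hn; grind)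
          (swap₃ _ _ _ _ hn hA))
    by_cases hpa : p = a
    · subst hpa
      exact ⟨b, c, d, h, hA⟩
    by_cases hpb : p = b
    · subst hpb
      exact ⟨a, c, d, by clear * - h; grind, swap₁ _ _ _ _ h hA⟩
    by_cases hpc : p = c
    · subst hpc
      exact ⟨a, b, d, by clear * - h; grind, swap₁ _ _ _ _ (by clear * - h; grind)
          (swap₂ _ _ _ _ h hA)⟩
    by_cases hpd : p = d
    · subst hpd
      exact ⟨a, b, c, by clear * - h; grind, bring _ _ _ _ h hA⟩
    · exact ⟨a, b, c, by clear * - h hpa hpb hpc hpd; grind,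
        bring _ _ _ _ (by clear * - h hpa hpb hpc hpd; grind)
        (exchange a b c d p (by clear * - h hpa hpb hpc hpd; grind) hA)⟩
  clear hA h
  obtain ⟨b, c, d, h, hA⟩ := first
  have second : ∃ c d, [p, q, c, d].Nodup ∧ A p q c d := by
    by_cases hqb : q = b
    · subst hqb
      exact ⟨c, d, h, hA⟩
    by_cases hqc : q = c
    · subst hqc
      exact ⟨b, d, by clear * - h; grind, swap₂ _ _ _ _ h hA⟩
    by_cases hqd : q = d
    · subst hqd
      exact ⟨b, c, by clear * - h; grind,
          swap₂ _ _ _ _ (by clear * - h; grind)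
          (swap₃ _ _ _ _ h hA)⟩
    · exact ⟨b, c, by clear * - h h' hqb hqc hqd; grind,
        swap₂ _ _ _ _ (by clear * - h h' hqb hqc hqd; grind)
        (swap₃ _ _ _ _ (by clear * - h h' hqb hqc hqd; grind)
        (exchange p b c d q (by clear * - h h' hqb hqc hqd; grind) hA))⟩
  clear hA h
  obtain ⟨c, d, h, hA⟩ := second
  have third : ∃ d, [p, q, r, d].Nodup ∧ A p q r d := by
    by_cases hrc : r = c
    · subst hrc
      exact ⟨d, h, hA⟩
    by_cases hrd : r = d
    · subst hrd
      exact ⟨c, by clear * - h; grind, swap₃ _ _ _ _ h hA⟩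
    · exact ⟨c, by clear * - h h' hrc hrd; grind,
        swap₃ _ _ _ _ (by clear * - h h' hrc hrd; grind)
        (exchange p q c d r (by clear * - h h' hrc hrd; grind) hA)⟩
  clear hA h
  obtain ⟨d, h, hA⟩ := third
  by_cases hsd : s = d
  · exact hsd ▸ hA
  · exact exchange p q r d s (by clear * - h h' hsd; grind) hA

theorem agree_exchange (hP : Pi4Free P) (hP' : Pi4Free P')
    (h : ∀ p q r s : α, Crosses P p q r s ↔ Crosses P' p q r s)
    (hn : [a, b, c, d, e].Nodup) (hA : Agree P P' a b c d) : Agree P P' a b c e := by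
  simp only [List.nodup_cons, List.mem_cons, List.not_mem_nil, or_false, not_or, not_false_eq_true,
    List.nodup_nil, and_true] at hn
  obtain ⟨⟨hab, hac, had, hae⟩, ⟨hbc, hbd, hbe⟩, ⟨hcd, hce⟩, hde⟩ := hn
  have pa := agree_parity P P' hab hac had hae hbc hbd hbe hcd hce hde
  have pb := agree_parity P P' (Ne.symm hab) hbc hbd hbe hac had hae hcd hce hde
  have pc := agree_parity P P' (Ne.symm hac) (Ne.symm hbc) hcd hce hab had hae hbd hbe hde
  have pd := agree_parity P P' (Ne.symm had) (Ne.symm hbd) (Ne.symm hcd) hde hab hac hae hbc hbe hce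
  have pe := agree_parity P P' (Ne.symm hae) (Ne.symm hbe) (Ne.symm hce) (Ne.symm hde)
    hab hac had hbc hbd hcd
  have vertex : ∀ {x y z w : α}, x ≠ y → x ≠ z → x ≠ w → y ≠ z → y ≠ w → z ≠ w →
      (Agree P P' y x z w ↔ Agree P P' x y z w) ∧ (Agree P P' z x y w ↔ Agree P P' x y z w) ∧
      (Agree P P' w x y z ↔ Agree P P' x y z w) := by
    intro x y z w hxy hxz hxw hyz hyw hzw
    refine ⟨agree_vertex_swap_iff hP hP' h hxy hxz hxw hyz hyw hzw, ?_, ?_⟩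
    · rw [agree_vertex_swap_iff hP hP' h hxz hxy hxw hyz.symm hzw hyw,
        ← agree_rotate_iff hxz hxy hxw, agree_swap_iff hxy hxz hxw hyz hyw hzw]
    · rw [agree_vertex_swap_iff hP hP' h hxw hxy hxz hyw.symm hzw.symm hyz,
        agree_rotate_iff hxw hxy hxz]
  have v1 := vertex hab hac had hbc hbd hcd
  have v2 := vertex hab hac hae hbc hbe hce
  have v3 := vertex hab had hae hbd hbe hde
  have v4 := vertex hac had hae hcd hce hde
  have v5 := vertex hbc hbd hbe hcd hce hde
  simp only [v1, v2, v3, v4, v5] at pa pb pc pd pe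
  clear v1 v2 v3 v4 v5 vertex h hP hP'
  grind

/-- Having the same crossings forces global agreement or global disagreement. -/
theorem agree_iff_agree (hP : Pi4Free P) (hP' : Pi4Free P')
    (h : ∀ p q r s : α, Crosses P p q r s ↔ Crosses P' p q r s) {p q r s : α}
    (hn : [a, b, c, d].Nodup) (hn' : [p, q, r, s].Nodup) (hA : Agree P P' a b c d) :
    Agree P P' p q r s := by
  refine quadruple_iff_of_exchange (A := Agree P P') ?_ ?_ ?_
    (fun _ _ _ _ _ hn => agree_exchange hP hP' h hn) hn hn' hA
  all_goals
    intro a b c d hn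
    simp only [List.nodup_cons, List.mem_cons, List.not_mem_nil, or_false, not_or,
      not_false_eq_true, List.nodup_nil, and_true] at hn
    obtain ⟨⟨hab, hac, had⟩, ⟨hbc, hbd⟩, hcd⟩ := hn
  · exact (agree_vertex_swap_iff hP hP' h hab hac had hbc hbd hcd).2
  · rw [← agree_rotate_iff hac hab had, agree_swap_iff hab hac had hbc hbd hcd]
    exact id
  · exact (agree_swap_iff hab hac had hbc hbd hcd).2

theorem rotOrd_of_isReflection (h : IsReflection P P') (hb : v ≠ b) :
    rotOrd P' v b c d ↔ rotOrd P v b d c := by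
  rw [rotOrd, h v]
  exact cycOrd_inv_iff (P.cyc v) (by simp [hb.symm])

theorem crosses_of_isReflection (h : IsReflection P P') (p q r s : α) :
    Crosses P p q r s ↔ Crosses P' p q r s := by
  unfold Crosses
  refine and_congr_right fun ⟨hpq, hpr, hps, hqr, hqs, hrs⟩ => ?_
  simp only [rotOrd_of_isReflection h hpq, rotOrd_of_isReflection h hpq.symm,
    rotOrd_of_isReflection h hpr.symm, rotOrd_of_isReflection h hps.symm]
  tauto

end RotationSystems

/-- Two Π4°-free pre-rotation systems on the same finite set have the same
set of crossing pairs of disjoint edges if and only if one equals the other or its reflection. -/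
theorem crossings_determine_prerotation_system
    {α : Type*} [Fintype α] [DecidableEq α]
    (P P' : PreRotSys α) (hP : Pi4Free P) (hP' : Pi4Free P') :
    (∀ p q r s : α, Crosses P p q r s ↔ Crosses P' p q r s) ↔
      ((∀ v, P'.rot v = P.rot v) ∨ IsReflection P P') := by
  constructor
  · intro h
    by_cases hall : ∀ v b c d, [v, b, c, d].Nodup → Agree P P' v b c d
    · left
      intro v
      refine (P'.cyc v).ext (P.cyc v) fun b hb c hc d hd hbc hbd hcd => ?_
      exact (hall v b c d (by grind)).symm
    · right
      push Not at hall
      obtain ⟨a₀, b₀, c₀, d₀, hn₀, hne⟩ := hall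
      intro v
      refine (P'.cyc v).ext (P.cyc v).inv fun b hb c hc d hd hbc hbd hcd => ?_
      have hdis : ¬ Agree P P' v b c d :=
        fun hA => hne (agree_iff_agree hP hP' h (by grind) hn₀ hA)
      rw [cycOrd_inv_iff (P.cyc v) hb, cycOrd_swap_iff (P.cyc v) hb hc hd hbc hbd hcd]
      unfold Agree rotOrd at hdis
      tauto
  · rintro (h | h) p q r s
    · simp only [Crosses, rotOrd, h]
    · exact crosses_of_isReflection h p q r s
end

section
/- Let σ and σ' be cyclic permutations of a finite set S with |S| ≥ 4. If σ' is neither equal to σ nor to the reverse of σ, then there exists a 4-element subset J ⊆ S such that the restricted cyclic permutation σ'|_J is neither equal to σ|_J nor to the reverse of σ|_J. -/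
section CyclicPerm

variable {α : Type*} {f : Equiv.Perm α} {S : Finset α} {a b c : α}

namespace IsCyclicPermOn

theorem apply_mem (hf : IsCyclicPermOn f S) (ha : a ∈ S) : f a ∈ S := by
  by_contra h
  exact h ((f.injective (hf.1 _ h)).symm ▸ ha)

theorem iterate_mem (hf : IsCyclicPermOn f S) (ha : a ∈ S) (k : ℕ) : (⇑f)^[k] a ∈ S := by
  induction k with
  | zero => exact ha
  | succ k ih => rw [Function.iterate_succ_apply']; exact hf.apply_mem ih

theorem minimalPeriod_pos (hf : IsCyclicPermOn f S) (ha : a ∈ S) :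
    0 < Function.minimalPeriod f a := by
  obtain ⟨k, hk⟩ := hf.2 _ (hf.apply_mem ha) _ ha
  exact Function.IsPeriodicPt.minimalPeriod_pos k.succ_pos hk

theorem exists_iterate_lt_minimalPeriod (hf : IsCyclicPermOn f S) (ha : a ∈ S) (hb : b ∈ S) :
    ∃ i < Function.minimalPeriod f a, (⇑f)^[i] a = b := by
  obtain ⟨k, rfl⟩ := hf.2 a ha b hb
  exact ⟨k % Function.minimalPeriod f a, Nat.mod_lt _ (hf.minimalPeriod_pos ha),
    Function.iterate_mod_minimalPeriod_eq⟩

theorem minimalPeriod_eq_card (hf : IsCyclicPermOn f S) (ha : a ∈ S) :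
    Function.minimalPeriod f a = S.card := by
  rw [← Finset.card_range (Function.minimalPeriod f a)]
  refine Finset.card_bij (fun i _ => (⇑f)^[i] a) (fun i _ => hf.iterate_mem ha i) ?_ ?_
  · intro i hi j hj h
    exact Function.iterate_injOn_Iio_minimalPeriod (Finset.mem_range.1 hi)
      (Finset.mem_range.1 hj) h
  · intro b hb
    obtain ⟨i, hi, h⟩ := hf.exists_iterate_lt_minimalPeriod ha hb
    exact ⟨i, Finset.mem_range.2 hi, h⟩

theorem exists_iterate_lt (hf : IsCyclicPermOn f S) (ha : a ∈ S) (hb : b ∈ S) :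
    ∃ i < S.card, (⇑f)^[i] a = b :=
  hf.minimalPeriod_eq_card ha ▸ hf.exists_iterate_lt_minimalPeriod ha hb

theorem iterate_inj (hf : IsCyclicPermOn f S) (ha : a ∈ S) {i j : ℕ} (hi : i < S.card)
    (hj : j < S.card) (h : (⇑f)^[i] a = (⇑f)^[j] a) : i = j := by
  rw [← hf.minimalPeriod_eq_card ha] at hi hj
  exact Function.iterate_injOn_Iio_minimalPeriod hi hj h

theorem apply_ne (hf : IsCyclicPermOn f S) (hS : 1 < S.card) (ha : a ∈ S) : f a ≠ a := fun h =>
  one_ne_zero (hf.iterate_inj ha (i := 1) (j := 0) hS (by omega) h)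

theorem inv_apply_mem (hf : IsCyclicPermOn f S) (ha : a ∈ S) : f⁻¹ a ∈ S := by
  by_contra h
  have := hf.1 _ h
  rw [← Equiv.Perm.mul_apply, mul_inv_cancel, Equiv.Perm.one_apply] at this
  exact h (this ▸ ha)

theorem cycOrd_asymm (hf : IsCyclicPermOn f S) (ha : a ∈ S) (h : CycOrd f S a b c) :
    ¬ CycOrd f S a c b := by
  rintro ⟨k, l, -, hkl, hl, hc, hb⟩
  obtain ⟨i, j, -, hij, hj, hb', hc'⟩ := h
  have h₁ := hf.iterate_inj ha (hij.trans hj) hl (hb'.trans hb.symm)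
  have h₂ := hf.iterate_inj ha hj (hkl.trans hl) (hc'.trans hc.symm)
  omega

theorem cycOrd_or_cycOrd (hf : IsCyclicPermOn f S) (ha : a ∈ S) (hb : b ∈ S) (hc : c ∈ S)
    (hab : a ≠ b) (hac : a ≠ c) (hbc : b ≠ c) : CycOrd f S a b c ∨ CycOrd f S a c b := by
  obtain ⟨i, hi, rfl⟩ := hf.exists_iterate_lt ha hb
  obtain ⟨j, hj, rfl⟩ := hf.exists_iterate_lt ha hc
  have hi0 : 0 < i := Nat.pos_of_ne_zero fun h => hab (by simp [h])
  have hj0 : 0 < j := Nat.pos_of_ne_zero fun h => hac (by simp [h])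
  rcases lt_trichotomy i j with h | h | h
  · exact Or.inl ⟨i, j, hi0, h, hj, rfl, rfl⟩
  · exact absurd (by rw [h]) hbc
  · exact Or.inr ⟨j, i, hj0, h, hi, rfl, rfl⟩

theorem cycOrd_swap_iff (hf : IsCyclicPermOn f S) (ha : a ∈ S) (hb : b ∈ S) (hc : c ∈ S)
    (hab : a ≠ b) (hac : a ≠ c) (hbc : b ≠ c) : CycOrd f S a c b ↔ ¬ CycOrd f S a b c :=
  ⟨fun h => hf.cycOrd_asymm ha h, (hf.cycOrd_or_cycOrd ha hb hc hab hac hbc).resolve_left⟩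

theorem cycOrd_apply (hf : IsCyclicPermOn f S) (ha : a ∈ S) (hb : b ∈ S)
    (hab : a ≠ b) (hfab : f a ≠ b) : CycOrd f S a (f a) b := by
  obtain ⟨j, hj, rfl⟩ := hf.exists_iterate_lt ha hb
  have h0 : j ≠ 0 := by rintro rfl; exact hab rfl
  have h1 : j ≠ 1 := by rintro rfl; exact hfab rfl
  exact ⟨1, j, one_pos, by omega, hj, rfl, rfl⟩

theorem cycOrd_inv_apply (hf : IsCyclicPermOn f S) (ha : a ∈ S) (hb : b ∈ S)
    (hab : a ≠ b) (hfab : f⁻¹ a ≠ b) : CycOrd f S a b (f⁻¹ a) := by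
  obtain ⟨i, hi, rfl⟩ := hf.exists_iterate_lt ha hb
  have h0 : i ≠ 0 := by rintro rfl; exact hab rfl
  have hlast : (⇑f)^[S.card - 1] a = f⁻¹ a := by
    rw [Equiv.Perm.eq_inv_iff_eq, ← Function.iterate_succ_apply' f,
      Nat.succ_eq_add_one, Nat.sub_add_cancel (by omega), ← hf.minimalPeriod_eq_card ha,
      Function.iterate_minimalPeriod]
  have h1 : i ≠ S.card - 1 := by rintro rfl; exact hfab hlast.symm
  exact ⟨i, S.card - 1, by omega, by omega, by omega, rfl, hlast⟩

theorem exists_mem_apply_ne {g : Equiv.Perm α} (hf : IsCyclicPermOn f S)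
    (hg : ∀ a ∉ S, g a = a) (h : f ≠ g) : ∃ a ∈ S, f a ≠ g a := by
  by_contra! H
  refine h (Equiv.ext fun a => ?_)
  by_cases ha : a ∈ S
  · exact H a ha
  · rw [hf.1 a ha, hg a ha]

end IsCyclicPermOn

/-- A property of triples of distinct elements of `S` which is constant on each four-element
subset of `S` is constant. -/
theorem triple_iff_of_forall_four (hS : 4 ≤ S.card) (P : α → α → α → Prop)
    (h : ∀ J ⊆ S, J.card = 4 → ∀ x ∈ J, ∀ y ∈ J, ∀ z ∈ J, ∀ u ∈ J, ∀ v ∈ J, ∀ w ∈ J,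
      x ≠ y → x ≠ z → y ≠ z → u ≠ v → u ≠ w → v ≠ w → (P x y z ↔ P u v w))
    {x y z u v w : α} (hx : x ∈ S) (hy : y ∈ S) (hz : z ∈ S) (hu : u ∈ S) (hv : v ∈ S)
    (hw : w ∈ S) (hxy : x ≠ y) (hxz : x ≠ z) (hyz : y ≠ z) (huv : u ≠ v) (huw : u ≠ w)
    (hvw : v ≠ w) : P x y z ↔ P u v w := by
  classical
  have four : ∀ T ⊆ S, T.card ≤ 4 → ∃ J ⊆ S, J.card = 4 ∧ T ⊆ J := fun T hT hc => by
    obtain ⟨J, hTJ, hJS, hJ⟩ := Finset.exists_subsuperset_card_eq hT hc hS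
    exact ⟨J, hJS, hJ, hTJ⟩
  have step : ∀ x ∈ S, ∀ y ∈ S, ∀ z ∈ S, ∀ w ∈ S, x ≠ y → x ≠ z → y ≠ z → x ≠ w → y ≠ w →
      (P x y z ↔ P x y w) ∧ (P x y z ↔ P x z y) ∧ (P x y z ↔ P y z x) := by
    intro x hx y hy z hz w hw hxy hxz hyz hxw hyw
    obtain ⟨J, hJS, hJ, hTJ⟩ := four {x, y, z, w}
      (by simp [Finset.insert_subset_iff, hx, hy, hz, hw]) Finset.card_le_four
    simp only [Finset.insert_subset_iff, Finset.singleton_subset_iff] at hTJ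
    obtain ⟨jx, jy, jz, jw⟩ := hTJ
    exact ⟨h J hJS hJ x jx y jy z jz x jx y jy w jw hxy hxz hyz hxy hxw hyw,
      h J hJS hJ x jx y jy z jz x jx z jz y jy hxy hxz hyz hxz hxy hyz.symm,
      h J hJS hJ x jx y jy z jz y jy z jz x jx hxy hxz hyz hyz hxy.symm hxz.symm⟩
  have swap : ∀ x ∈ S, ∀ y ∈ S, ∀ z ∈ S, x ≠ y → x ≠ z → y ≠ z → (P x y z ↔ P x z y) :=
    fun x hx y hy z hz hxy hxz hyz => (step x hx y hy z hz z hz hxy hxz hyz hxz hyz).2.1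
  have rotate : ∀ x ∈ S, ∀ y ∈ S, ∀ z ∈ S, x ≠ y → x ≠ z → y ≠ z → (P x y z ↔ P y z x) :=
    fun x hx y hy z hz hxy hxz hyz => (step x hx y hy z hz z hz hxy hxz hyz hxz hyz).2.2
  have replace_two : ∀ x ∈ S, ∀ y ∈ S, ∀ z ∈ S, ∀ v ∈ S, ∀ w ∈ S, x ≠ y → x ≠ z → y ≠ z →
      x ≠ v → x ≠ w → v ≠ w → (P x y z ↔ P x v w) := by
    intro x hx y hy z hz v hv w hw hxy hxz hyz hxv hxw hvw
    rw [swap x hx y hy z hz hxy hxz hyz]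
    by_cases hzv : z = v
    · subst hzv
      exact (step x hx z hz y hy w hw hxz hxy hyz.symm hxw hvw).1
    · rw [(step x hx z hz y hy v hv hxz hxy hyz.symm hxv hzv).1,
        swap x hx z hz v hv hxz hxv hzv]
      exact (step x hx v hv z hz w hw hxv hxz (Ne.symm hzv) hxw hvw).1
  by_cases hxv : x = v
  · subst hxv
    rw [rotate u hu x hv w hw huv huw hvw]
    exact replace_two x hx y hy z hz w hw u hu hxy hxz hyz hvw huv.symm huw.symm
  by_cases hxw : x = w
  · subst hxw
    rw [← rotate x hx u hu v hv huw.symm hvw.symm huv]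
    exact replace_two x hx y hy z hz u hu v hv hxy hxz hyz huw.symm hvw.symm huv
  rw [replace_two x hx y hy z hz v hv w hw hxy hxz hyz hxv hxw hvw,
    rotate x hx v hv w hw hxv hxw hvw, rotate u hu v hv w hw huv huw hvw]
  exact (step v hv w hw x hx u hu hvw (Ne.symm hxv) (Ne.symm hxw) huv.symm huw.symm).1

end CyclicPerm

/-- Two cyclic permutations of a finite set `S` with `|S| ≥ 4` which are
neither equal nor reverses of each other already differ, in the same sense, on the
restriction to some 4-element subset (equality of the restrictions being expressed via the
ternary cyclic-order relation, which determines cyclic permutations of sets of size ≥ 3). -/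
theorem cyclic_perms_differ_on_four_element_subset
    {α : Type*} (S : Finset α) (hS : 4 ≤ S.card)
    (σ σ' : Equiv.Perm α) (hσ : IsCyclicPermOn σ S) (hσ' : IsCyclicPermOn σ' S)
    (hne : σ' ≠ σ) (hnr : σ' ≠ σ⁻¹) :
    ∃ J : Finset α, J ⊆ S ∧ J.card = 4 ∧
      ¬ (∀ b ∈ J, ∀ c ∈ J, ∀ d ∈ J, (CycOrd σ' S b c d ↔ CycOrd σ S b c d)) ∧
      ¬ (∀ b ∈ J, ∀ c ∈ J, ∀ d ∈ J, (CycOrd σ' S b c d ↔ CycOrd σ S b d c)) := by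
  have h1 : 1 < S.card := by omega
  by_contra! H
  have key : ∀ J ⊆ S, J.card = 4 → ∀ x ∈ J, ∀ y ∈ J, ∀ z ∈ J, ∀ u ∈ J, ∀ v ∈ J, ∀ w ∈ J,
      x ≠ y → x ≠ z → y ≠ z → u ≠ v → u ≠ w → v ≠ w →
      ((CycOrd σ' S x y z ↔ CycOrd σ S x y z) ↔ (CycOrd σ' S u v w ↔ CycOrd σ S u v w)) := by
    intro J hJS hJ x hx y hy z hz u hu v hv w hw hxy hxz hyz huv huw hvw
    by_cases hE : ∀ b ∈ J, ∀ c ∈ J, ∀ d ∈ J, (CycOrd σ' S b c d ↔ CycOrd σ S b c d)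
    · exact iff_of_true (hE x hx y hy z hz) (hE u hu v hv w hw)
    · have hR : ∀ b ∈ J, ∀ c ∈ J, ∀ d ∈ J, (CycOrd σ' S b c d ↔ CycOrd σ S b d c) := by
        by_contra hR
        push Not at hE
        exact hR (H J hJS hJ hE)
      rw [hR x hx y hy z hz, hR u hu v hv w hw,
        hσ.cycOrd_swap_iff (hJS hx) (hJS hy) (hJS hz) hxy hxz hyz,
        hσ.cycOrd_swap_iff (hJS hu) (hJS hv) (hJS hw) huv huw hvw]
      tauto
  obtain ⟨a, ha, hσa⟩ := hσ'.exists_mem_apply_ne hσ.1 hne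
  obtain ⟨b, hb, hσb⟩ := hσ'.exists_mem_apply_ne
    (fun a ha => Equiv.Perm.inv_eq_iff_eq.2 (hσ.1 a ha).symm) hnr
  have hσ'a := (hσ'.apply_ne h1 ha).symm
  have hσ'b := (hσ'.apply_ne h1 hb).symm
  have ha' := (hσ.apply_ne h1 ha).symm
  have hb' : b ≠ σ⁻¹ b := fun h =>
    hσ.apply_ne h1 hb (Equiv.Perm.eq_inv_iff_eq.1 h)
  have hiff := triple_iff_of_forall_four hS
    (fun x y z => CycOrd σ' S x y z ↔ CycOrd σ S x y z) key
    ha (hσ'.apply_mem ha) (hσ.apply_mem ha) hb (hσ'.apply_mem hb) (hσ.inv_apply_mem hb)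
    hσ'a ha' hσa hσ'b hb' hσb
  have hagree := hiff.2 (iff_of_true
    (hσ'.cycOrd_apply hb (hσ.inv_apply_mem hb) hb' hσb)
    (hσ.cycOrd_inv_apply hb (hσ'.apply_mem hb) hσ'b hσb.symm))
  exact hσ.cycOrd_asymm ha (hσ.cycOrd_apply ha (hσ'.apply_mem ha) hσ'a hσa.symm)
    (hagree.1 (hσ'.cycOrd_apply ha (hσ.apply_mem ha) ha' hσa))
end

section
/- Let n ≥ 3 and let σ assign to every triple i < j < k of elements of {1,…,n} a sign σ(i,j,k) ∈ {+,−}. Then there exists a cyclic permutation π of {1,…,n} such that σ(i,j,k) = + exactly when i, j, k appear in this cyclic order in π if and only if for all i < j < k < ℓ the sign sequence (σ(i,j,k), σ(i,j,ℓ), σ(i,k,ℓ), σ(j,k,ℓ)) is one of the six patterns (+,+,+,+), (+,+,−,−), (+,−,−,+), (−,−,−,−), (−,−,+,+), (−,+,+,−). -/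
/-- `p` numbers the points of the cycle of `f` by residues modulo `n`, in cyclic order. -/
def IsCyclicNumbering {α : Type*} (n : ℕ) (f : Equiv.Perm α) (p : α → ℕ) : Prop :=
  (∀ x, p x < n) ∧ ∀ k b c, (⇑f)^[k] b = c ↔ p b + k ≡ p c [MOD n]

/-- `a, b, c` are in increasing order up to a rotation. -/
def CyclicallyIncreasing (a b c : ℕ) : Prop :=
  (a < b ∧ b < c) ∨ (b < c ∧ c < a) ∨ (c < a ∧ a < b)

lemma add_modEq_iff_of_lt {n a b i : ℕ} (ha : a < n) (hb : b < n) (hi : i < n) :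
    a + i ≡ b [MOD n] ↔ a + i = b ∨ a + i = b + n := by
  unfold Nat.ModEq
  rw [Nat.mod_eq_of_lt hb]
  rcases lt_or_ge (a + i) n with h | h
  · rw [Nat.mod_eq_of_lt h]
    omega
  · rw [Nat.mod_eq_sub_mod h, Nat.mod_eq_of_lt (by omega)]
    omega

lemma IsCyclicNumbering.injective {α : Type*} {n : ℕ} {f : Equiv.Perm α} {p : α → ℕ}
    (h : IsCyclicNumbering n f p) : Function.Injective p := fun b c hbc =>
  (h.2 0 b c).2 (by simp [hbc, Nat.ModEq])

lemma IsCyclicNumbering.isCyclicPermOn_univ {α : Type*} [Fintype α] {n : ℕ}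
    {f : Equiv.Perm α} {p : α → ℕ} (h : IsCyclicNumbering n f p) :
    IsCyclicPermOn f Finset.univ := by
  refine ⟨fun a ha => absurd (Finset.mem_univ a) ha, fun a _ b _ => ⟨p b + n - p a, ?_⟩⟩
  have ha := h.1 a
  rw [h.2, show p a + (p b + n - p a) = p b + n by omega]
  simp [Nat.ModEq]

lemma IsCyclicNumbering.cycOrd_univ_iff {n : ℕ} {f : Equiv.Perm (Fin n)} {p : Fin n → ℕ}
    (h : IsCyclicNumbering n f p) (b c d : Fin n) :
    CycOrd f Finset.univ b c d ↔ CyclicallyIncreasing (p b) (p c) (p d) := by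
  have hb := h.1 b
  have hc := h.1 c
  have hd := h.1 d
  simp only [CycOrd, CyclicallyIncreasing, Finset.card_univ, Fintype.card_fin, h.2]
  constructor
  · rintro ⟨i, j, hi, hij, hj, h1, h2⟩
    rw [add_modEq_iff_of_lt hb hc (by omega)] at h1
    rw [add_modEq_iff_of_lt hb hd hj] at h2
    omega
  · intro hcyc
    have key : ∀ a < n, ∃ i < n, p b + i = a ∨ p b + i = a + n := fun a ha => by
      rcases le_or_gt (p b) a with hab | hab
      · exact ⟨a - p b, by omega, by omega⟩
      · exact ⟨a + n - p b, by omega, by omega⟩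
    obtain ⟨i, hi, h1⟩ := key _ hc
    obtain ⟨j, hj, h2⟩ := key _ hd
    refine ⟨i, j, by omega, by omega, hj, ?_, ?_⟩
    · rwa [add_modEq_iff_of_lt hb hc hi]
    · rwa [add_modEq_iff_of_lt hb hd hj]

lemma IsCyclicPermOn.exists_isCyclicNumbering {n : ℕ} [NeZero n] {f : Equiv.Perm (Fin n)}
    (hf : IsCyclicPermOn f Finset.univ) : ∃ p, IsCyclicNumbering n f p := by
  have hcyc : f.IsCycleOn ((Finset.univ : Finset (Fin n)) : Set (Fin n)) := by
    refine ⟨by simp, fun a _ b _ => ?_⟩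
    obtain ⟨k, hk⟩ := hf.2 a (Finset.mem_univ a) b (Finset.mem_univ b)
    exact ⟨k, by simpa [Equiv.Perm.iterate_eq_pow] using hk⟩
  choose p hp hpx using fun x : Fin n =>
    hcyc.exists_pow_eq (Finset.mem_univ 0) (Finset.mem_univ x)
  refine ⟨p, by simpa using hp, fun k b c => ?_⟩
  have hmod := hcyc.pow_apply_eq_pow_apply (Finset.mem_univ 0) (m := k + p b) (n := p c)
  rw [pow_add, Equiv.Perm.mul_apply, hpx, hpx, Finset.card_univ, Fintype.card_fin] at hmod
  rw [Equiv.Perm.iterate_eq_pow, hmod, add_comm]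

lemma val_finRotate_iterate {n : ℕ} (k : ℕ) (x : Fin n) :
    (((⇑(finRotate n))^[k] x : Fin n) : ℕ) = (x + k) % n := by
  obtain _ | m := n
  · exact x.elim0
  induction k with
  | zero => simp [Nat.mod_eq_of_lt x.isLt]
  | succ k ih =>
    rw [Function.iterate_succ_apply', finRotate_apply, Fin.val_add, ih]
    simp [add_assoc]

/-- Every injective numbering of the points comes from a cyclic permutation. -/
lemma exists_isCyclicNumbering_of_injective {n : ℕ} {p : Fin n → ℕ} (hlt : ∀ x, p x < n)
    (hp : Function.Injective p) : ∃ f : Equiv.Perm (Fin n), IsCyclicNumbering n f p := by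
  let q : Fin n → Fin n := fun x => ⟨p x, hlt x⟩
  have hq : Function.Bijective q :=
    Finite.injective_iff_bijective.1 fun x y hxy => hp (congrArg Fin.val hxy)
  let e : Equiv.Perm (Fin n) := Equiv.ofBijective q hq
  let f : Equiv.Perm (Fin n) := (e.trans (finRotate n)).trans e.symm
  have hsemi : Function.Semiconj e f (finRotate n) := fun x => by simp [f]
  refine ⟨f, hlt, fun k b c => ?_⟩
  rw [← e.apply_eq_iff_eq, hsemi.iterate_right k b, Fin.ext_iff, val_finRotate_iterate]
  change (p b + k) % n = p c ↔ (p b + k) % n = p c % n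
  rw [Nat.mod_eq_of_lt (hlt c)]

/-- A strict total order on `Fin n` is the order of an injective numbering by `0, …, n - 1`. -/
lemma exists_numbering_of_strictTotalOrder {n : ℕ} (r : Fin n → Fin n → Prop)
    (irrefl : ∀ x, ¬ r x x) (trans : ∀ x y z, r x y → r y z → r x z)
    (total : ∀ x y, x ≠ y → r x y ∨ r y x) :
    ∃ p : Fin n → ℕ, (∀ x, p x < n) ∧ Function.Injective p ∧ ∀ x y, p x < p y ↔ r x y := by
  classical
  let p : Fin n → ℕ := fun x => (Finset.univ.filter fun y => r y x).card
  have hmono : ∀ x y, r x y → p x < p y := fun x y hxy => by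
    refine Finset.card_lt_card (Finset.ssubset_iff_of_subset ?_ |>.2 ⟨x, ?_, ?_⟩)
    · intro z hz
      simp only [Finset.mem_filter, Finset.mem_univ, true_and] at hz ⊢
      exact trans z x y hz hxy
    · simpa using hxy
    · simpa using irrefl x
  refine ⟨p, fun x => ?_, fun x y hxy => ?_, fun x y => ⟨fun hxy => ?_, hmono x y⟩⟩
  · have : p x < (Finset.univ : Finset (Fin n)).card :=
      Finset.card_lt_card (Finset.ssubset_iff_of_subset (Finset.subset_univ _) |>.2
        ⟨x, Finset.mem_univ x, by simpa using irrefl x⟩)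
    simpa using this
  · by_contra hne
    rcases total x y hne with h | h
    · exact absurd hxy (hmono x y h).ne
    · exact absurd hxy (hmono y x h).ne'
  · by_contra hr
    rcases eq_or_ne x y with rfl | hne
    · exact lt_irrefl _ hxy
    · exact lt_asymm hxy (hmono y x ((total x y hne).resolve_left hr))

/-- The linear order obtained by cutting a cyclic order with signs `σ` open at `0`. -/
def cutAtZero {n : ℕ} [NeZero n] (σ : Fin n → Fin n → Fin n → Bool) (x y : Fin n) : Prop :=
  (x = 0 ∧ 0 < y) ∨ (0 < x ∧ x < y ∧ σ 0 x y = true) ∨ (0 < y ∧ y < x ∧ σ 0 y x = false)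

/-- A sign assignment `σ` on ordered triples `i < j < k` of `{1, …, n}`
(`true` = `+`) is realized by a cyclic permutation `π` of all `n` elements (i.e.
`σ(i,j,k) = +` exactly when `i, j, k` appear in this cyclic order in `π`) if and only if
on every quadruple `i < j < k < ℓ` the sign pattern
`(σ(i,j,k), σ(i,j,ℓ), σ(i,k,ℓ), σ(j,k,ℓ))` is one of the six allowed patterns. -/
theorem cyclic_permutation_sign_characterization
    (n : ℕ) (hn : 3 ≤ n) (σ : Fin n → Fin n → Fin n → Bool) :
    (∃ π : Equiv.Perm (Fin n), IsCyclicPermOn π (Finset.univ : Finset (Fin n)) ∧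
        ∀ i j k : Fin n, i < j → j < k →
          (σ i j k = true ↔ CycOrd π Finset.univ i j k)) ↔
      (∀ i j k l : Fin n, i < j → j < k → k < l →
        (σ i j k, σ i j l, σ i k l, σ j k l) ∈
          [(true, true, true, true), (true, true, false, false),
           (true, false, false, true), (false, false, false, false),
           (false, false, true, true), (false, true, true, false)]) := by
  have : NeZero n := ⟨by omega⟩
  constructor
  · rintro ⟨π, hπ, hσ⟩ i j k l hij hjk hkl
    obtain ⟨p, hp⟩ := hπ.exists_isCyclicNumbering
    have h1 := hσ i j k hij hjk
    have h2 := hσ i j l hij (hjk.trans hkl)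
    have h3 := hσ i k l (hij.trans hjk) hkl
    have h4 := hσ j k l hjk hkl
    rw [hp.cycOrd_univ_iff, CyclicallyIncreasing] at h1 h2 h3 h4
    have n1 := hp.injective.ne hij.ne
    have n2 := hp.injective.ne hjk.ne
    have n3 := hp.injective.ne hkl.ne
    have n4 := hp.injective.ne (hij.trans hjk).ne
    have n5 := hp.injective.ne (hjk.trans hkl).ne
    have n6 := hp.injective.ne (hij.trans (hjk.trans hkl)).ne
    revert h1 h2 h3 h4
    cases σ i j k <;> cases σ i j l <;> cases σ i k l <;> cases σ j k l <;>
      simp only [reduceCtorEq, true_iff, false_iff] <;> intro h1 h2 h3 h4 <;>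
      first | decide | omega
  · intro H
    have H0 : ∀ i j k : Fin n, 0 < i → i < j → j < k → _ := fun i j k hi hij hjk =>
      H 0 i j k hi hij hjk
    have hpos : ∀ x : Fin n, x = 0 ∨ 0 < x := fun x => (Fin.zero_le x).eq_or_lt.imp_left Eq.symm
    obtain ⟨p, hlt, hinj, hp⟩ := exists_numbering_of_strictTotalOrder (cutAtZero σ)
      (by
        intro x
        simp only [cutAtZero]
        grind)
      (by
        intro x y z hxy hyz
        have h1 := H0 x y z
        have h2 := H0 x z y
        have h3 := H0 y x z
        have h4 := H0 y z x
        have h5 := H0 z x y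
        have h6 := H0 z y x
        simp only [cutAtZero, List.mem_cons, Prod.mk.injEq, List.not_mem_nil] at *
        grind)
      (by
        intro x y hne
        have := hpos x
        have := hpos y
        simp only [cutAtZero]
        grind)
    obtain ⟨π, hπ⟩ := exists_isCyclicNumbering_of_injective hlt hinj
    refine ⟨π, hπ.isCyclicPermOn_univ, fun i j k hij hjk => ?_⟩
    have h1 := H0 i j k
    rw [hπ.cycOrd_univ_iff]
    have := hpos i
    simp only [CyclicallyIncreasing, hp, cutAtZero, List.mem_cons, Prod.mk.injEq,
      List.not_mem_nil] at *
    grind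
end

section
/- In a Π4°-free pre-rotation system, for any four distinct elements, at most one of the three partitions of these four elements into two disjoint edges forms a crossing pair. -/
/-- Iterating a cyclic permutation of `S` fewer than `S.card` times does not return to the
starting point. -/
theorem IsCyclicPermOn.iterate_ne_self {α : Type*} [DecidableEq α] {f : Equiv.Perm α}
    {S : Finset α} (hf : IsCyclicPermOn f S) {x : α} (hx : x ∈ S) {n : ℕ} (hn : 0 < n)
    (hnS : n < S.card) : (⇑f)^[n] x ≠ x := by
  intro h
  have hsub : S ⊆ (Finset.range n).image fun k => (⇑f)^[k] x := by
    intro y hy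
    obtain ⟨k, rfl⟩ := hf.2 x hx y hy
    exact Finset.mem_image.2 ⟨k % n, Finset.mem_range.2 (Nat.mod_lt _ hn),
      Function.IsPeriodicPt.iterate_mod_apply h k⟩
  have hcard := (Finset.card_le_card hsub).trans Finset.card_image_le
  rw [Finset.card_range] at hcard
  omega

theorem IsCyclicPermOn.iterate_injOn {α : Type*} [DecidableEq α] {f : Equiv.Perm α}
    {S : Finset α} (hf : IsCyclicPermOn f S) {x : α} (hx : x ∈ S) :
    Set.InjOn (fun k => (⇑f)^[k] x) (Set.Iio S.card) := by
  have key : ∀ m n, m < n → n < S.card → (⇑f)^[m] x ≠ (⇑f)^[n] x := by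
    intro m n hmn hn h
    refine hf.iterate_ne_self hx (Nat.sub_pos_of_lt hmn) (by omega) ?_
    apply f.injective.iterate m
    rw [← Function.iterate_add_apply, Nat.add_sub_cancel' hmn.le, h]
  intro m hm n hn h
  rcases lt_trichotomy m n with hmn | hmn | hmn
  · exact absurd h (key m n hmn hn)
  · exact hmn
  · exact absurd h.symm (key n m hmn hm)

theorem CycOrd.asymm {α : Type*} [DecidableEq α] {f : Equiv.Perm α} {S : Finset α}
    (hf : IsCyclicPermOn f S) {x y z : α} (hx : x ∈ S) (h : CycOrd f S x y z) :
    ¬ CycOrd f S x z y := by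
  rintro ⟨i', j', -, hij', hj', hi'z, hj'y⟩
  obtain ⟨i, j, -, hij, hj, hiy, hjz⟩ := h
  have h₁ : i = j' := hf.iterate_injOn hx (hij.trans hj) hj' (hiy.trans hj'y.symm)
  have h₂ : j = i' := hf.iterate_injOn hx hj (hij'.trans hj') (hjz.trans hi'z.symm)
  omega

theorem rotOrd.asymm {α : Type*} [Fintype α] [DecidableEq α] {P : PreRotSys α} {v x y z : α}
    (hxv : x ≠ v) (h : rotOrd P v x y z) : ¬ rotOrd P v x z y :=
  CycOrd.asymm (P.cyc v) (by simp [hxv]) h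

/-- In a Π4°-free pre-rotation system, for any four distinct elements
`a, b, c, d`, at most one of the three partitions of `{a,b,c,d}` into two disjoint edges
(`{a,c}{b,d}`, `{a,b}{c,d}`, `{a,d}{b,c}`) forms a crossing pair. -/
theorem at_most_one_crossing_partition
    {α : Type*} [Fintype α] [DecidableEq α]
    (P : PreRotSys α) (hP : Pi4Free P)
    (a b c d : α) (hab : a ≠ b) (hac : a ≠ c) (had : a ≠ d)
    (hbc : b ≠ c) (hbd : b ≠ d) (hcd : c ≠ d) :
    ¬ (Crosses P a b c d ∧ Crosses P a c b d) ∧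
    ¬ (Crosses P a b c d ∧ Crosses P a b d c) ∧
    ¬ (Crosses P a c b d ∧ Crosses P a b d c) := by
  refine ⟨?_, ?_, ?_⟩
  · rintro ⟨⟨-, ⟨-, hb, -, hd⟩ | ⟨-, hb, -, hd⟩⟩, ⟨-, ⟨-, -, hb', hd'⟩ | ⟨-, -, hb', hd'⟩⟩⟩
    exacts [hd.asymm had hd', hb.asymm hab hb', hb.asymm hab hb', hd.asymm had hd']
  · rintro ⟨⟨-, ⟨ha, -, -, hd⟩ | ⟨ha, -, -, hd⟩⟩, ⟨-, ⟨ha', -, hd', -⟩ | ⟨ha', -, hd', -⟩⟩⟩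
    exacts [ha.asymm hab.symm ha', hd.asymm had hd', hd.asymm had hd', ha.asymm hab.symm ha']
  · rintro ⟨⟨-, ⟨-, hc, hb, -⟩ | ⟨-, hc, hb, -⟩⟩, ⟨-, ⟨-, hb', -, hc'⟩ | ⟨-, hb', -, hc'⟩⟩⟩
    exacts [hb.asymm hab hb', hc.asymm hac hc', hc.asymm hac hc', hb.asymm hab hb']
end

section
/- Up to isomorphism (relabelling, possibly followed by reflection), there are exactly 3 pre-rotation systems on a 4-element set, and exactly 2 of these 3 isomorphism classes are Π4°-free. -/
open Equiv

/-- The counterclockwise rotations of the planar drawing of `K₄`. -/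
def planarRot : Fin 4 → Perm (Fin 4) :=
  ![swap 1 2 * swap 2 3, swap 0 3 * swap 3 2, swap 0 1 * swap 1 3, swap 0 2 * swap 2 1]

theorem planarRot_conj (e : Perm (Fin 4)) (v : Fin 4) :
    e * planarRot v * e⁻¹ = planarRot (e v) ^ (Perm.sign e : ℤ) := by
  revert e v
  decide

theorem planarRot_zpow_injective (v : Fin 4) :
    Function.Injective fun u : ℤˣ => planarRot v ^ (u : ℤ) := by
  unfold Function.Injective
  revert v
  decide

theorem isCyclicPermOn_planarRot_zpow (u : ℤˣ) (v : Fin 4) :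
    IsCyclicPermOn (planarRot v ^ (u : ℤ)) (Finset.univ.erase v) := by
  have h : ∀ (u : ℤˣ) (v : Fin 4),
      (∀ a ∉ Finset.univ.erase v, (planarRot v ^ (u : ℤ)) a = a) ∧
      ∀ a ∈ Finset.univ.erase v, ∀ b ∈ Finset.univ.erase v,
        ∃ k : Fin 3, (⇑(planarRot v ^ (u : ℤ)))^[k] a = b := by
    decide
  exact ⟨(h u v).1, fun a ha b hb => ((h u v).2 a ha b hb).imp' _ fun _ => id⟩

theorem IsCyclicPermOn.exists_eq_planarRot_zpow {f : Perm (Fin 4)} {v : Fin 4}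
    (hf : IsCyclicPermOn f (Finset.univ.erase v)) :
    ∃ u : ℤˣ, f = planarRot v ^ (u : ℤ) := by
  have h : ∀ (v : Fin 4) (f : Perm (Fin 4)), f v = v → (∀ a, a ≠ v → f a ≠ a) →
      ∃ u : ℤˣ, f = planarRot v ^ (u : ℤ) := by
    decide
  refine h v f (hf.1 v (by simp)) fun a ha hfa => ?_
  obtain ⟨b, hbv, hba⟩ : ∃ b, b ≠ v ∧ b ≠ a := by
    have : ∀ v a : Fin 4, ∃ b, b ≠ v ∧ b ≠ a := by decide
    exact this v a
  obtain ⟨k, hk⟩ := hf.2 a (by simpa) b (by simpa)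
  exact hba (hk ▸ Function.iterate_fixed hfa k)

/-- The pre-rotation system on four elements whose rotation at `v` is the planar one or its
reverse, according to the sign `s v`. -/
def ofSigns (s : Fin 4 → ℤˣ) : PreRotSys (Fin 4) where
  rot v := planarRot v ^ (s v : ℤ)
  cyc v := isCyclicPermOn_planarRot_zpow (s v) v

theorem ofSigns_surjective : Function.Surjective ofSigns := by
  rintro ⟨rot, cyc⟩
  choose s hs using fun v => (cyc v).exists_eq_planarRot_zpow
  exact ⟨s, by simp only [ofSigns, ← hs]⟩

theorem isoPRS_ofSigns_iff_exists (s t : Fin 4 → ℤˣ) :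
    IsoPRS (ofSigns s) (ofSigns t) ↔
      ∃ (e : Perm (Fin 4)) (u : ℤˣ), ∀ v, t (e v) = u * s v := by
  have key (e : Perm (Fin 4)) (v : Fin 4) : e * (ofSigns s).rot v * e⁻¹ =
      planarRot (e v) ^ ((Perm.sign e * s v : ℤˣ) : ℤ) := by
    rw [ofSigns, ← conj_zpow, planarRot_conj, ← zpow_mul, Units.val_mul]
  simp only [IsoPRS, key, ← zpow_neg, ← Units.val_neg]
  simp only [ofSigns, (planarRot_zpow_injective _).eq_iff]
  refine exists_congr fun e => ⟨?_, ?_⟩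
  · rintro (h | h)
    exacts [⟨_, h⟩, ⟨-Perm.sign e, by simpa using h⟩]
  · rintro ⟨u, h⟩
    have hu : ∀ u w : ℤˣ, u = w ∨ u = -w := by decide
    rcases hu u (Perm.sign e) with rfl | rfl
    exacts [.inl h, .inr (by simpa using h)]

theorem exists_perm_signs_iff (s t : Fin 4 → ℤˣ) :
    (∃ (e : Perm (Fin 4)) (u : ℤˣ), ∀ v, t (e v) = u * s v) ↔
      |∑ v, (s v : ℤ)| = |∑ v, (t v : ℤ)| := by
  constructor
  · rintro ⟨e, u, h⟩
    rw [← Equiv.sum_comp e (fun v => (t v : ℤ))]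
    simp [h, ← Finset.mul_sum, abs_mul, Int.isUnit_iff_abs_eq.1 u.isUnit]
  · have h : ∀ s t : Fin 4 → ℤˣ, |∑ v, (s v : ℤ)| = |∑ v, (t v : ℤ)| →
      ∃ (u : ℤˣ), ∃ (e : Perm (Fin 4)), ∀ v, t (e v) = u * s v := by decide
    intro hst
    obtain ⟨u, e, h⟩ := h s t hst
    exact ⟨e, u, h⟩

theorem cycOrd_iff_of_card_eq_three {α : Type*} {f : Perm α} {S : Finset α}
    (hS : S.card = 3) (b c d : α) : CycOrd f S b c d ↔ f b = c ∧ f c = d := by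
  constructor
  · rintro ⟨i, j, hi, hij, hj, rfl, rfl⟩
    obtain ⟨rfl, rfl⟩ : i = 1 ∧ j = 2 := by omega
    exact ⟨rfl, rfl⟩
  · rintro ⟨rfl, rfl⟩
    exact ⟨1, 2, by omega, by omega, by omega, rfl, rfl⟩

theorem pi4Free_ofSigns_iff (s : Fin 4 → ℤˣ) :
    Pi4Free (ofSigns s) ↔ |∑ v, (s v : ℤ)| ≠ 2 := by
  have hcard (v : Fin 4) : (Finset.univ.erase v).card = 3 := by simp
  simp only [Pi4Free, rotOrd, cycOrd_iff_of_card_eq_three (hcard _), ofSigns]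
  clear hcard
  revert s
  decide

theorem natCard_quot_of_surjective {α β γ : Type*} [Fintype β] [DecidableEq γ]
    {r : α → α → Prop} {g : β → α} (hg : Function.Surjective g) (f : β → γ)
    (h : ∀ x y, r (g x) (g y) ↔ f x = f y) :
    Nat.card (Quot r) = (Finset.univ.image f).card := by
  have hinv (x : β) : f (Function.surjInv hg (g x)) = f x := by
    rw [← h, Function.surjInv_eq hg, h]
  rw [← Nat.card_eq_finsetCard]
  refine Nat.card_congr (Equiv.ofBijective (Quot.lift
    (fun a => ⟨f (Function.surjInv hg a), Finset.mem_image_of_mem f (Finset.mem_univ _)⟩)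
    fun a b hab => Subtype.ext ?_) ⟨?_, ?_⟩)
  · rwa [← h, Function.surjInv_eq hg, Function.surjInv_eq hg]
  · rintro ⟨a⟩ ⟨b⟩ hab
    obtain ⟨x, rfl⟩ := hg a
    obtain ⟨y, rfl⟩ := hg b
    refine Quot.sound ((h x y).2 ?_)
    simpa [hinv] using hab
  · rintro ⟨c, hc⟩
    obtain ⟨x, -, rfl⟩ := Finset.mem_image.1 hc
    exact ⟨Quot.mk r (g x), Subtype.ext (hinv x)⟩

/-- Up to isomorphism (relabelling, possibly followed by reflection),
there are exactly 3 pre-rotation systems on a 4-element set, and exactly 2 of these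
3 isomorphism classes are Π4°-free. -/
theorem prerotation_systems_on_four_elements_up_to_iso :
    Nat.card (Quot (IsoPRS (α := Fin 4))) = 3 ∧
    Nat.card (Quot (fun P P' : {Q : PreRotSys (Fin 4) // Pi4Free Q} =>
      IsoPRS P.1 P'.1)) = 2 := by
  have hiso (s t : Fin 4 → ℤˣ) : IsoPRS (ofSigns s) (ofSigns t) ↔
      |∑ v, (s v : ℤ)| = |∑ v, (t v : ℤ)| :=
    (isoPRS_ofSigns_iff_exists s t).trans (exists_perm_signs_iff s t)
  constructor
  · rw [natCard_quot_of_surjective ofSigns_surjective _ hiso]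
    decide
  · let g (s : {s : Fin 4 → ℤˣ // |∑ v, (s v : ℤ)| ≠ 2}) : {Q : PreRotSys (Fin 4) // Pi4Free Q} :=
      ⟨ofSigns s.1, (pi4Free_ofSigns_iff s.1).2 s.2⟩
    have hg : Function.Surjective g := by
      rintro ⟨Q, hQ⟩
      obtain ⟨s, rfl⟩ := ofSigns_surjective Q
      exact ⟨⟨s, (pi4Free_ofSigns_iff s).1 hQ⟩, rfl⟩
    rw [natCard_quot_of_surjective hg (fun s => |∑ v, (s.1 v : ℤ)|) fun s t => hiso s.1 t.1]
    decide
end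

section
/- Up to isomorphism (relabelling, possibly followed by reflection), there are exactly 7 Π4°-free pre-rotation systems on a 5-element set. -/
open Equiv

namespace PreRotSys

theorem _root_.Equiv.Perm.iterate_conj {α : Type*} (e f : Perm α) (n : ℕ) (x : α) :
    (⇑(e * f * e⁻¹))^[n] (e x) = e ((⇑f)^[n] x) :=
  ((Function.Semiconj.iterate_right (f := e) (ga := f) (gb := ⇑(e * f * e⁻¹))
    (fun y => by simp) n) x).symm

section Relabel

variable {α : Type*} [Fintype α] [DecidableEq α]

theorem isoPRS_refl (P : PreRotSys α) : IsoPRS P P := ⟨1, Or.inl fun v => by simp⟩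

theorem isoPRS_symm {P Q : PreRotSys α} : IsoPRS P Q → IsoPRS Q P := by
  rintro ⟨e, h | h⟩ <;> refine ⟨e⁻¹, ?_⟩
  · left
    intro v
    obtain ⟨v, rfl⟩ := e.surjective v
    rw [h, ← Perm.mul_apply, inv_mul_cancel, Perm.one_apply]
    group
  · right
    intro v
    obtain ⟨v, rfl⟩ := e.surjective v
    rw [h, ← Perm.mul_apply, inv_mul_cancel, Perm.one_apply]
    group

theorem isoPRS_trans {P Q R : PreRotSys α} : IsoPRS P Q → IsoPRS Q R → IsoPRS P R := by
  rintro ⟨e, h | h⟩ ⟨e', h' | h'⟩ <;> refine ⟨e' * e, ?_⟩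
  on_goal 1 => left
  on_goal 2 => right
  on_goal 3 => right
  on_goal 4 => left
  all_goals
    intro v
    rw [Perm.mul_apply, h', h]
    group

theorem isoPRS_equivalence : Equivalence (IsoPRS (α := α)) :=
  ⟨isoPRS_refl, isoPRS_symm, isoPRS_trans⟩

/-- The pre-rotation system obtained from `P` by relabelling the elements along `e`. -/
def relabel (e : Perm α) (P : PreRotSys α) : PreRotSys α where
  rot v := e * P.rot (e⁻¹ v) * e⁻¹
  cyc v := by
    obtain ⟨hfix, htrans⟩ := P.cyc (e⁻¹ v)
    refine ⟨fun a ha => ?_, fun a ha b hb => ?_⟩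
    · have := hfix (e⁻¹ a) (by simpa using ha)
      rw [Perm.mul_apply, Perm.mul_apply, this, Perm.inv_def, apply_symm_apply]
    · obtain ⟨k, hk⟩ := htrans (e⁻¹ a) (by simpa using ha) (e⁻¹ b) (by simpa using hb)
      refine ⟨k, ?_⟩
      have := Perm.iterate_conj e (P.rot (e⁻¹ v)) k (e⁻¹ a)
      rw [hk] at this
      simpa using this

theorem isoPRS_relabel (e : Perm α) (P : PreRotSys α) : IsoPRS P (P.relabel e) :=
  ⟨e, Or.inl fun v => by simp [relabel]⟩

theorem rotOrd_relabel (e : Perm α) (P : PreRotSys α) (v b c d : α) :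
    rotOrd (P.relabel e) (e v) (e b) (e c) (e d) ↔ rotOrd P v b c d := by
  have hrot : (P.relabel e).rot (e v) = e * P.rot v * e⁻¹ := by simp [relabel]
  simp only [rotOrd, CycOrd, hrot, Perm.iterate_conj, EmbeddingLike.apply_eq_iff_eq,
    Finset.card_erase_of_mem (Finset.mem_univ _)]

theorem pi4Free_relabel (e : Perm α) {P : PreRotSys α} (h : Pi4Free P) :
    Pi4Free (P.relabel e) := by
  intro a b c d
  obtain ⟨a, rfl⟩ := e.surjective a
  obtain ⟨b, rfl⟩ := e.surjective b
  obtain ⟨c, rfl⟩ := e.surjective c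
  obtain ⟨d, rfl⟩ := e.surjective d
  simpa only [rotOrd_relabel, ne_eq, EmbeddingLike.apply_eq_iff_eq] using h a b c d

end Relabel

theorem _root_.IsCyclicPermOn.exists_lt_card {α : Type*} {f : Perm α} {S : Finset α}
    (h : IsCyclicPermOn f S) {a b : α} (ha : a ∈ S) (hb : b ∈ S) :
    ∃ k < S.card, (⇑f)^[k] a = b := by
  have hmem : ∀ x ∈ S, f x ∈ S := fun x hx => by
    by_contra hfx
    exact hfx ((f.injective (h.1 _ hfx)).symm ▸ hx)
  have hcyc : f.IsCycleOn S := by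
    refine ⟨⟨hmem, f.injective.injOn, ?_⟩, fun x hx y hy => ?_⟩
    · exact Finset.surjOn_of_injOn_of_card_le f hmem f.injective.injOn le_rfl
    · obtain ⟨k, hk⟩ := h.2 x hx y hy
      exact ⟨k, by simpa [Perm.coe_pow] using hk⟩
  obtain ⟨k, hk, hka⟩ := hcyc.exists_pow_eq ha hb
  exact ⟨k, hk, by simpa [Perm.coe_pow] using hka⟩

/-- For each of the six cyclic permutations of `{1, 2, 3, 4}`, fixing `0`, the number with decimal
digits its values at `4, 3, 2, 1, 0`. -/
def fourCycleDigits : Fin 6 → ℕ := ![14320, 31420, 12430, 24130, 21340, 32140]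

/-- The translate by `v` of the map with decimal digits `n`. -/
def digitMap (n : ℕ) (v x : Fin 5) : Fin 5 :=
  ⟨(n / Nat.pow 10 ((x.val + 5 - v.val) % 5) % 10 + v.val) % 5, Nat.mod_lt _ (by simp)⟩

/-- The six cyclic permutations of `Fin 5` without `v`. -/
def cycleAt (v : Fin 5) (k : Fin 6) : Perm (Fin 5) where
  toFun := digitMap (fourCycleDigits k) v
  invFun := digitMap (fourCycleDigits (![5, 3, 4, 1, 2, 0] k)) v
  left_inv := by unfold Function.LeftInverse; decide +kernel +revert
  right_inv := by unfold Function.RightInverse Function.LeftInverse; decide +kernel +revert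

theorem isCyclicPermOn_cycleAt (v : Fin 5) (k : Fin 6) :
    IsCyclicPermOn (cycleAt v k) (Finset.univ.erase v) := by
  have h : (∀ a ∉ Finset.univ.erase v, cycleAt v k a = a) ∧
      ∀ a ∈ Finset.univ.erase v, ∀ b ∈ Finset.univ.erase v,
        ∃ n : Fin 4, (⇑(cycleAt v k))^[n] a = b := by
    decide +kernel +revert
  exact ⟨h.1, fun a ha b hb => (h.2 a ha b hb).imp' _ fun _ => id⟩

theorem exists_eq_cycleAt {f : Perm (Fin 5)} {v : Fin 5}
    (h : IsCyclicPermOn f (Finset.univ.erase v)) : ∃ k, f = cycleAt v k := by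
  have key : ∀ (v : Fin 5) (f : Perm (Fin 5)), (f v = v ∧
      ∀ a, a ≠ v → ∀ b, b ≠ v → ∃ n : Fin 4, (⇑f)^[n] a = b) → ∃ k, f = cycleAt v k := by
    decide +kernel
  refine key v f ⟨h.1 v (by simp), fun a ha b hb => ?_⟩
  obtain ⟨n, hn, hna⟩ := h.exists_lt_card (a := a) (b := b) (by simpa) (by simpa)
  exact ⟨⟨n, by simpa using hn⟩, hna⟩

/-- The pre-rotation system on `Fin 5` whose rotation at `v` is `cycleAt v (k v)`. -/
def ofCode (k : Fin 5 → Fin 6) : PreRotSys (Fin 5) :=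
  ⟨fun v => cycleAt v (k v), fun v => isCyclicPermOn_cycleAt v (k v)⟩

theorem exists_eq_ofCode (P : PreRotSys (Fin 5)) : ∃ k, P = ofCode k := by
  choose k hk using fun v => exists_eq_cycleAt (P.cyc v)
  refine ⟨k, ?_⟩
  cases P
  simp only [ofCode, mk.injEq]
  exact funext hk

theorem rotOrd_fin_five (P : PreRotSys (Fin 5)) (v b c d : Fin 5) :
    rotOrd P v b c d ↔
      (P.rot v b = c ∧ (P.rot v c = d ∨ P.rot v (P.rot v c) = d)) ∨
        (P.rot v (P.rot v b) = c ∧ P.rot v c = d) := by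
  have hcard : (Finset.univ.erase v).card = 4 := by simp
  unfold rotOrd CycOrd
  rw [hcard]
  constructor
  · rintro ⟨i, j, hi, hij, hj, rfl, rfl⟩
    have : (i = 1 ∧ j = 2) ∨ (i = 1 ∧ j = 3) ∨ (i = 2 ∧ j = 3) := by omega
    rcases this with ⟨rfl, rfl⟩ | ⟨rfl, rfl⟩ | ⟨rfl, rfl⟩ <;> simp
  · rintro (⟨rfl, rfl | rfl⟩ | ⟨rfl, rfl⟩)
    exacts [⟨1, 2, by simp⟩, ⟨1, 3, by simp⟩, ⟨2, 3, by simp⟩]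

theorem rotOrd_ofCode (k : Fin 5 → Fin 6) {v b c d : Fin 5} (hb : b ≠ v) (hc : c ≠ v)
    (hd : d ≠ v) (hbc : b ≠ c) (hbd : b ≠ d) (hcd : c ≠ d) :
    rotOrd (ofCode k) v b c d ↔ cycleAt v (k v) b = c ∨ cycleAt v (k v) c = d := by
  rw [rotOrd_fin_five]
  simp only [ofCode]
  generalize k v = m
  decide +kernel +revert

instance (P : PreRotSys (Fin 5)) (v b c d : Fin 5) : Decidable (rotOrd P v b c d) :=
  decidable_of_iff' _ (rotOrd_fin_five P v b c d)

instance : DecidablePred (Pi4Free (α := Fin 5)) := fun P => by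
  unfold Pi4Free
  infer_instance

section Maps

variable {α : Type*} [Fintype α] [DecidableEq α]

/-- `e` is an injection carrying the rotations of `P` to those of `Q`. -/
def PreservesRot (P Q : PreRotSys α) (e : α → α) : Prop :=
  (∀ v x, Q.rot (e v) (e x) = e (P.rot v x)) ∧ Function.Injective e

/-- `e` is an injection carrying the rotations of `P` to the inverses of those of `Q`. -/
def ReversesRot (P Q : PreRotSys α) (e : α → α) : Prop :=
  (∀ v x, Q.rot (e v) (e (P.rot v x)) = e x) ∧ Function.Injective e

theorem isoPRS_iff_exists_map {P Q : PreRotSys α} :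
    IsoPRS P Q ↔ ∃ e : α → α, PreservesRot P Q e ∨ ReversesRot P Q e := by
  constructor
  · rintro ⟨e, h | h⟩
    · exact ⟨e, Or.inl ⟨fun v x => by simp [h], e.injective⟩⟩
    · exact ⟨e, Or.inr ⟨fun v x => by simp [h], e.injective⟩⟩
  · rintro ⟨e, h⟩
    have he : Function.Injective e := h.elim And.right And.right
    refine ⟨Equiv.ofBijective e (Finite.injective_iff_bijective.mp he), ?_⟩
    refine h.imp (fun h v => ?_) (fun h v => ?_)
    · rw [eq_mul_inv_iff_mul_eq]
      ext x
      simp [h.1]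
    · rw [eq_inv_iff_mul_eq_one, ← mul_assoc, mul_inv_eq_one]
      ext x
      simp [h.1]

end Maps

/-- `v` and `w` followed by the next three iterates of `w` under `f`. -/
def frame (f : Perm (Fin 5)) (v w : Fin 5) : Fin 5 → Fin 5 :=
  ![v, w, f w, f (f w), f (f (f w))]

/-- If `0` has rotation `(1, 2, 3, 4)`, then an isomorphism is determined by the images of `0` and
`1` and by whether it reflects. -/
theorem isoPRS_iff_exists_frame {P Q : PreRotSys (Fin 5)} (hP : P.rot 0 = cycleAt 0 0) :
    IsoPRS P Q ↔ ∃ v w, v ≠ w ∧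
      (PreservesRot P Q (frame (Q.rot v) v w) ∨ ReversesRot P Q (frame (Q.rot v)⁻¹ v w)) := by
  have h1 : P.rot 0 1 = 2 := by rw [hP]; rfl
  have h2 : P.rot 0 2 = 3 := by rw [hP]; rfl
  have h3 : P.rot 0 3 = 4 := by rw [hP]; rfl
  rw [isoPRS_iff_exists_map]
  constructor
  · rintro ⟨e, h | h⟩ <;> refine ⟨e 0, e 1, h.2.ne (by decide), ?_⟩
    · left
      convert h
      have e1 := h.1 0 1
      have e2 := h.1 0 2
      have e3 := h.1 0 3
      rw [h1] at e1
      rw [h2] at e2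
      rw [h3] at e3
      funext u
      fin_cases u <;> simp [frame, e1, e2, e3]
    · right
      convert h
      have e1 := Perm.eq_inv_iff_eq.mpr (h.1 0 1)
      have e2 := Perm.eq_inv_iff_eq.mpr (h.1 0 2)
      have e3 := Perm.eq_inv_iff_eq.mpr (h.1 0 3)
      rw [h1] at e1
      rw [h2] at e2
      rw [h3] at e3
      funext u
      fin_cases u <;> simp only [frame, ← e1, ← e2, ← e3] <;> rfl
  · rintro ⟨v, w, -, h | h⟩
    exacts [⟨_, Or.inl h⟩, ⟨_, Or.inr h⟩]

/- The rotations at `0` match by construction of `frame`, so the other vertices are tested first. -/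
instance (P Q : PreRotSys (Fin 5)) (e : Fin 5 → Fin 5) : Decidable (PreservesRot P Q e) :=
  decidable_of_iff ((∀ v x : Fin 5, Q.rot (e v.rev) (e x) = e (P.rot v.rev x)) ∧
      ∀ x y, e x = e y → x = y)
    (and_congr_left' (Fin.rev_surjective.forall
      (p := fun v => ∀ x, Q.rot (e v) (e x) = e (P.rot v x))).symm)

instance (P Q : PreRotSys (Fin 5)) (e : Fin 5 → Fin 5) : Decidable (ReversesRot P Q e) :=
  decidable_of_iff ((∀ v x : Fin 5, Q.rot (e v.rev) (e (P.rot v.rev x)) = e x) ∧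
      ∀ x y, e x = e y → x = y)
    (and_congr_left' (Fin.rev_surjective.forall
      (p := fun v => ∀ x, Q.rot (e v) (e (P.rot v x)) = e x)).symm)

/-- Codes of representatives of the Π4°-free pre-rotation systems on five elements. -/
def repCode : Fin 7 → Fin 5 → Fin 6 :=
  ![![0, 0, 0, 0, 0], ![0, 0, 0, 3, 4], ![0, 0, 2, 4, 2], ![0, 0, 3, 0, 1],
    ![0, 1, 0, 4, 5], ![0, 1, 3, 0, 5], ![0, 2, 4, 5, 1]]

theorem pi4Free_repCode (i : Fin 7) : Pi4Free (ofCode (repCode i)) := by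
  decide +kernel +revert

/-- The restriction of `Pi4Free` to quadruples whose last vertex is arbitrary, while the first
three follow it in the cyclic order of `Fin 5`. The cyclic order of three elements is read off
as in `rotOrd_ofCode`. -/
def Pi4FreeCyclic (P : PreRotSys (Fin 5)) : Prop :=
  ∀ (d : Fin 5) (t : Fin 4),
    let a := d + (t.succAbove 0).succ
    let b := d + (t.succAbove 1).succ
    let c := d + (t.succAbove 2).succ
    let r (v x y z : Fin 5) : Prop := P.rot v x = y ∨ P.rot v y = z
    ¬ (r a b c d ∧ r b a c d ∧ r c a b d ∧ r d a c b) ∧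
    ¬ (r a b d c ∧ r b a d c ∧ r c a d b ∧ r d a b c)

instance : DecidablePred Pi4FreeCyclic := fun P => by
  unfold Pi4FreeCyclic
  infer_instance

theorem _root_.Pi4Free.pi4FreeCyclic {k : Fin 5 → Fin 6} (h : Pi4Free (ofCode k)) :
    Pi4FreeCyclic (ofCode k) := by
  intro d t a b c r
  have hne : a ≠ b ∧ a ≠ c ∧ a ≠ d ∧ b ≠ c ∧ b ≠ d ∧ c ≠ d := by
    clear h
    decide +kernel +revert
  obtain ⟨hab, hac, had, hbc, hbd, hcd⟩ := hne
  have hr {v x y z : Fin 5} (hx : x ≠ v) (hy : y ≠ v) (hz : z ≠ v) (hxy : x ≠ y) (hxz : x ≠ z)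
      (hyz : y ≠ z) : r v x y z ↔ rotOrd (ofCode k) v x y z :=
    (rotOrd_ofCode k hx hy hz hxy hxz hyz).symm
  have := h a b c d hab hac had hbc hbd hcd
  grind

theorem repCode_eq_of_isoPRS {i j : Fin 7} :
    IsoPRS (ofCode (repCode i)) (ofCode (repCode j)) → i = j := by
  have hrot : (ofCode (repCode i)).rot 0 = cycleAt 0 0 := by
    decide +kernel +revert
  rw [isoPRS_iff_exists_frame hrot]
  clear hrot
  decide +kernel +revert

theorem exists_isoPRS_repCode_of_normalized {a b c d : Fin 6}
    (h : Pi4Free (ofCode ![0, a, b, c, d])) :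
    ∃ i, IsoPRS (ofCode ![0, a, b, c, d]) (ofCode (repCode i)) := by
  have hrot : (ofCode ![0, a, b, c, d]).rot 0 = cycleAt 0 0 := rfl
  simp only [isoPRS_iff_exists_frame hrot]
  replace h := h.pi4FreeCyclic
  clear hrot
  decide +kernel +revert

theorem exists_conj_cycleAt_zero (k : Fin 6) :
    ∃ e : Perm (Fin 5), e 0 = 0 ∧ e * cycleAt 0 k * e⁻¹ = cycleAt 0 0 := by
  decide +kernel +revert

theorem cycleAt_injective (v : Fin 5) : Function.Injective (cycleAt v) := by
  decide +kernel +revert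

theorem exists_isoPRS_repCode {P : PreRotSys (Fin 5)} (h : Pi4Free P) :
    ∃ i, IsoPRS P (ofCode (repCode i)) := by
  obtain ⟨k, rfl⟩ := exists_eq_ofCode P
  obtain ⟨e, he0, he⟩ := exists_conj_cycleAt_zero (k 0)
  obtain ⟨l, hl⟩ := exists_eq_ofCode ((ofCode k).relabel e)
  have hl0 : l 0 = 0 := by
    apply cycleAt_injective 0
    have hrot : ((ofCode k).relabel e).rot 0 = (ofCode l).rot 0 := by rw [hl]
    have he0' : e⁻¹ 0 = 0 := by rw [Perm.inv_eq_iff_eq, he0]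
    simp only [relabel, ofCode, he0', he] at hrot
    exact hrot.symm
  have hvec : l = ![0, l 1, l 2, l 3, l 4] := by
    funext v
    fin_cases v <;> simp [hl0]
  have hfree := pi4Free_relabel e h
  rw [hl, hvec] at hfree
  obtain ⟨i, hi⟩ := exists_isoPRS_repCode_of_normalized hfree
  rw [← hvec, ← hl] at hi
  exact ⟨i, isoPRS_trans (isoPRS_relabel e _) hi⟩

end PreRotSys

/-- Up to isomorphism (relabelling, possibly followed by reflection),
there are exactly 7 Π4°-free pre-rotation systems on a 5-element set. -/
theorem pi4free_prerotation_systems_on_five_elements_up_to_iso :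
    Nat.card (Quot (fun P P' : {Q : PreRotSys (Fin 5) // Pi4Free Q} =>
      IsoPRS P.1 P'.1)) = 7 := by
  let rel (P P' : {Q : PreRotSys (Fin 5) // Pi4Free Q}) : Prop := IsoPRS P.1 P'.1
  have hrel : Equivalence rel := PreRotSys.isoPRS_equivalence.comap Subtype.val
  let rep (i : Fin 7) : Quot rel := Quot.mk rel ⟨_, PreRotSys.pi4Free_repCode i⟩
  have hrep : Function.Bijective rep := by
    refine ⟨fun i j hij => ?_, fun q => ?_⟩
    · exact PreRotSys.repCode_eq_of_isoPRS (hrel.eqvGen_iff.mp (Quot.eqvGen_exact hij))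
    · obtain ⟨⟨P, hP⟩, rfl⟩ := Quot.exists_rep q
      obtain ⟨i, hi⟩ := PreRotSys.exists_isoPRS_repCode hP
      exact ⟨i, Quot.sound (hrel.symm hi)⟩
  simpa using (Nat.card_eq_of_bijective rep hrep).symm
end
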